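/- Let n ∈ {4, 5}, p < 1, and 0 < τ1 < τ2. Suppose f : S^{n-1} → ℝ satisfies τ1 < f(u) < τ2 for all u ∈ S^{n-1}, and K ∈ K_0^n is a solution of the L_p Minkowski problem dS_{K,p} = f dH^{n-1} with o ∈ ∂K. If K is not smooth, then the linear span of N(K,o) is two-dimensional, and there exists u ∈ N(K,o), u ≠ 0, such that the face F(K,u) has dimension n − 1 (its affine hull is (n−1)-dimensional). -/

import Mathlib

open MeasureTheory Set
open scoped ENNReal NNReal RealInnerProductSpace

noncomputable section

/-- Support function of a set `K`. -/
def suppFn {n : ℕ} (K : Set (EuclideanSpace ℝ (Fin n))) (u : EuclideanSpace ℝ (Fin n)) : ℝ :=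
  sSup ((fun y => ⟪u, y⟫) '' K)

/-- Face of `K` with outer normal `u`. -/
def face {n : ℕ} (K : Set (EuclideanSpace ℝ (Fin n))) (u : EuclideanSpace ℝ (Fin n)) :
    Set (EuclideanSpace ℝ (Fin n)) :=
  {z ∈ K | ⟪z, u⟫ = suppFn K u}

/-- Normal cone of `K` at `z`. -/
def normalCone {n : ℕ} (K : Set (EuclideanSpace ℝ (Fin n))) (z : EuclideanSpace ℝ (Fin n)) :
    Set (EuclideanSpace ℝ (Fin n)) :=
  {u | ∀ y ∈ K, ⟪u, y⟫ ≤ ⟪u, z⟫}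

/-- The unit sphere `S^{n-1}` in `ℝ^n`. -/
def unitSphere (n : ℕ) : Set (EuclideanSpace ℝ (Fin n)) :=
  Metric.sphere (0 : EuclideanSpace ℝ (Fin n)) 1

/-- Surface area measure of `K` evaluated on `ω`:
`S_K(ω) = H^{n-1}(⋃_{u ∈ ω} F(K,u))`. -/
def surfMeas {n : ℕ} (K : Set (EuclideanSpace ℝ (Fin n)))
    (ω : Set (EuclideanSpace ℝ (Fin n))) : ℝ≥0∞ :=
  μH[(n : ℝ) - 1] (⋃ u ∈ ω, face K u)

/-- `K ∈ 𝒦₀ⁿ`: compact convex with nonempty interior, containing the origin. -/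
def IsConvexBody0 {n : ℕ} (K : Set (EuclideanSpace ℝ (Fin n))) : Prop :=
  IsCompact K ∧ Convex ℝ K ∧ (interior K).Nonempty ∧ (0 : EuclideanSpace ℝ (Fin n)) ∈ K

/-- `K` is a solution of the `L_p` Minkowski problem `dS_{K,p} = f dH^{n-1}`. -/
def IsLpSolution {n : ℕ} (p : ℝ) (f : EuclideanSpace ℝ (Fin n) → ℝ)
    (K : Set (EuclideanSpace ℝ (Fin n))) : Prop :=
  μH[(n : ℝ) - 1] {u ∈ unitSphere n | suppFn K u = 0} = 0 ∧
  ∀ ω : Set (EuclideanSpace ℝ (Fin n)), MeasurableSet ω →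
    ω ⊆ {u ∈ unitSphere n | 0 < suppFn K u} →
    surfMeas K ω
      = ∫⁻ u in ω, ENNReal.ofReal ((n : ℝ) * f u * suppFn K u ^ (p - 1)) ∂μH[(n : ℝ) - 1]

/-- `x` is a smooth boundary point: the normal cone spans a one-dimensional space. -/
def IsSmoothPt {n : ℕ} (K : Set (EuclideanSpace ℝ (Fin n)))
    (x : EuclideanSpace ℝ (Fin n)) : Prop :=
  Module.finrank ℝ (Submodule.span ℝ (normalCone K x)) = 1

/-- `K` is smooth: every boundary point is a smooth point. -/
def IsSmoothBody {n : ℕ} (K : Set (EuclideanSpace ℝ (Fin n))) : Prop :=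
  ∀ x ∈ frontier K, IsSmoothPt K x

/-- Subgradient of `v` at `x` relative to the domain `Ω`. -/
def subgrad {n : ℕ} (Ω : Set (EuclideanSpace ℝ (Fin n))) (v : EuclideanSpace ℝ (Fin n) → ℝ)
    (x : EuclideanSpace ℝ (Fin n)) : Set (EuclideanSpace ℝ (Fin n)) :=
  {z | ∀ y ∈ Ω, v x + ⟪z, y - x⟫ ≤ v y}

/-- Monge–Ampère measure of `v` (relative to domain `Ω`) evaluated on `ω`. -/
def maMeasure {n : ℕ} (Ω : Set (EuclideanSpace ℝ (Fin n))) (v : EuclideanSpace ℝ (Fin n) → ℝ)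
    (ω : Set (EuclideanSpace ℝ (Fin n))) : ℝ≥0∞ :=
  μH[(n : ℝ)] (⋃ x ∈ ω, subgrad Ω v x)

/-- Hessian matrix of `v : ℝ^n → ℝ` at `x`. -/
def hessMatrix {n : ℕ} (v : EuclideanSpace ℝ (Fin n) → ℝ) (x : EuclideanSpace ℝ (Fin n)) :
    Matrix (Fin n) (Fin n) ℝ :=
  Matrix.of fun i j =>
    fderiv ℝ (fun y => fderiv ℝ v y (EuclideanSpace.single j 1)) x (EuclideanSpace.single i 1)


section absMA
open scoped Pointwise
set_option linter.unusedSectionVars false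

variable {F : Type*} [NormedAddCommGroup F] [InnerProductSpace ℝ F] [FiniteDimensional ℝ F]
  [MeasurableSpace F] [BorelSpace F]

/-- global subdifferential -/
def sgr (v : F → ℝ) (y : F) : Set F := {q | ∀ y', v y + inner ℝ q (y' - y) ≤ v y'}

/-- subgradient image -/
def Dgr (v : F → ℝ) (ω : Set F) : Set F := ⋃ y ∈ ω, sgr v y

theorem sgr_of_min (w : F → ℝ) (hw : ConvexOn ℝ univ w) (hc : Continuous w)
    (hS : IsCompact {y | w y ≤ 0}) (xs : F) (M0 : ℝ) (hM0 : 0 < M0) (hxs : w xs = -M0)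
    (p : F) (hp : ∀ z, w z ≤ 0 → inner ℝ p (z - xs) ≤ M0) : p ∈ Dgr w {y | w y < 0} := by
  have hφc : Continuous (fun z => w z - inner ℝ p z) := by fun_prop
  have hxS : xs ∈ {y | w y ≤ 0} := by simp [hxs]; linarith
  obtain ⟨z, hz, hzmin⟩ := hS.exists_isMinOn ⟨xs, hxS⟩ hφc.continuousOn
  have hzmin' : ∀ y, w y ≤ 0 → w z - inner ℝ p z ≤ w y - inner ℝ p y := fun y hy => hzmin hy
  obtain ⟨x, hx0, hxmin⟩ : ∃ x, w x < 0 ∧ ∀ y, w y ≤ 0 → w x - inner ℝ p x ≤ w y - inner ℝ p y := by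
    rcases lt_or_ge (w z) 0 with h | h
    · exact ⟨z, h, hzmin'⟩
    · refine ⟨xs, by linarith, fun y hy => ?_⟩
      have h1 := hzmin' y hy
      have h2 := hp z hz
      rw [inner_sub_right] at h2
      linarith
  have hcv : ConvexOn ℝ univ (fun z => w z - inner ℝ p z) := by
    refine hw.sub ?_
    exact (innerSL ℝ p).toLinearMap.concaveOn convex_univ
  have hloc : IsLocalMin (fun z => w z - inner ℝ p z) x := by
    have : {y | w y < 0} ∈ nhds x := (isOpen_lt hc continuous_const).mem_nhds hx0
    filter_upwards [this] with y hy
    exact hxmin y (le_of_lt hy)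
  have hgl := IsMinOn.of_isLocalMin_of_convex_univ hloc hcv
  simp only [Dgr, mem_iUnion]
  refine ⟨x, hx0, fun y' => ?_⟩
  have := hgl y'
  rw [inner_sub_right]
  linarith

theorem core_MA (μ : Measure F) [μ.IsAddHaarMeasure] (w : F → ℝ) (hw : ConvexOn ℝ univ w)
    (hc : Continuous w)
    (hS : IsCompact {y | w y ≤ 0}) (xs g ξ : F) (M0 M α : ℝ) (hM0 : 0 < M0) (hxs : w xs = -M0)
    (hM : ∀ y, -M ≤ w y) (hMM : M ≤ 2 * M0) (hg : w g < 0) (hgd : w (g - (xs - g)) ≤ 0)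
    (J : ℕ) (hα : 0 < α) (hξ : ∀ z, w z ≤ 0 → inner ℝ ξ (z - xs) ≤ α)
    (hJ : 2 * J * α ≤ inner ℝ ξ (xs - g)) (hd : 0 < inner ℝ ξ (xs - g)) :
    ∃ P : ℝ≥0∞, P ≠ 0 ∧ P ≠ ⊤ ∧ (J + 1 : ℕ) * P ≤ μ (Dgr w {y | w y < 0}) ∧
      μ (Dgr w ((fun z => g + (1 / 2 : ℝ) • (z - g)) '' {y | w y < 0})) ≤
        ENNReal.ofReal (16 ^ Module.finrank ℝ F) * P := by
  set B : Set F := {p | ∀ z, w z ≤ 0 → inner ℝ p (z - g) ≤ M0 / 4} with hB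
  have hBcl : IsClosed B := by
    have : B = ⋂ z, ⋂ (_ : w z ≤ 0), {p | inner ℝ p (z - g) ≤ M0 / 4} := by
      ext p; simp [hB]
    rw [this]
    refine isClosed_iInter fun z => isClosed_iInter fun _ => isClosed_le (by fun_prop) (by fun_prop)
  have hxS : w xs ≤ 0 := by linarith
  -- B is bounded
  have hBbd : Bornology.IsBounded B := by
    have : {y | w y < 0} ∈ nhds g := (isOpen_lt hc continuous_const).mem_nhds hg
    obtain ⟨r, hr, hrs⟩ := Metric.mem_nhds_iff.1 this
    refine (Metric.isBounded_closedBall (x := (0 : F)) (r := M0 / (2 * r))).subset fun p hp => ?_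
    rw [mem_closedBall_zero_iff]
    by_cases hp0 : p = 0
    · subst hp0; simp; positivity
    have hpn : 0 < ‖p‖ := norm_pos_iff.2 hp0
    have h1 : g + (r / 2 / ‖p‖) • p ∈ Metric.ball g r := by
      rw [mem_ball_iff_norm]
      simp only [add_sub_cancel_left, norm_smul]
      rw [Real.norm_of_nonneg (by positivity)]
      field_simp
      linarith
    have h2 := hp _ (le_of_lt (hrs h1))
    simp only [add_sub_cancel_left, inner_smul_right, real_inner_self_eq_norm_sq] at h2
    rw [le_div_iff₀ (by positivity)]
    field_simp at h2
    nlinarith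
  have hBnhds : B ∈ nhds (0 : F) := by
    obtain ⟨R, hR⟩ := hS.isBounded.subset_closedBall g
    have hR' : ∀ z, w z ≤ 0 → ‖z - g‖ ≤ max R 1 := fun z hz =>
      le_max_of_le_left (by simpa [dist_eq_norm] using hR hz)
    have hm : 0 < max R 1 := by positivity
    refine Filter.mem_of_superset (Metric.ball_mem_nhds 0 (ε := M0 / 4 / max R 1) (by positivity))
      fun p hp z hz => ?_
    rw [mem_ball_zero_iff, lt_div_iff₀ hm] at hp
    calc inner ℝ p (z - g) ≤ ‖p‖ * ‖z - g‖ := real_inner_le_norm _ _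
      _ ≤ ‖p‖ * max R 1 := by gcongr; exact hR' z hz
      _ ≤ _ := hp.le
  have hSc : Convex ℝ {y | w y ≤ 0} := by simpa using hw.convex_le 0
  refine ⟨μ B, (Measure.measure_pos_of_mem_nhds μ hBnhds).ne', hBbd.measure_lt_top.ne, ?_, ?_⟩
  · set D := inner ℝ ξ (xs - g) with hD
    set T : ℕ → Set F := fun k => (fun p => ((k : ℝ) * M0 / D) • ξ + p) '' B with hT
    have hTm : ∀ k, MeasurableSet (T k) := fun k =>
      ((Homeomorph.addLeft (((k : ℝ) * M0 / D) • ξ)).isClosedMap B hBcl).measurableSet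
    have hTμ : ∀ k, μ (T k) = μ B := fun k => by
      simp only [hT, image_add_left, measure_preimage_add]
    have hBd : ∀ p ∈ B, |inner ℝ p (xs - g)| ≤ M0 / 4 := by
      intro p hp
      have h1 := hp xs hxS
      have h2 := hp _ hgd
      rw [show g - (xs - g) - g = -(xs - g) by abel, inner_neg_right] at h2
      exact abs_le.2 ⟨by linarith, h1⟩
    have hdisj : (↑(Finset.range (J + 1)) : Set ℕ).PairwiseDisjoint T := by
      intro i _ j _ hij
      rw [Function.onFun, Set.disjoint_left]
      rintro _ ⟨p, hp, rfl⟩ ⟨q, hq, hpq⟩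
      have h1 := hBd p hp
      have h2 := hBd q hq
      have h3 := congrArg (fun x => inner ℝ x (xs - g)) hpq
      simp only [inner_add_left, real_inner_smul_left, ← hD] at h3
      rw [div_mul_cancel₀ _ hd.ne', div_mul_cancel₀ _ hd.ne'] at h3
      rw [abs_le] at h1 h2
      rcases lt_or_gt_of_ne hij with h | h
      · have : (i : ℝ) + 1 ≤ j := by exact_mod_cast h
        nlinarith
      · have : (j : ℝ) + 1 ≤ i := by exact_mod_cast h
        nlinarith
    calc ((J + 1 : ℕ) : ℝ≥0∞) * μ B = ∑ k ∈ Finset.range (J + 1), μ (T k) := by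
          simp [hTμ]
      _ = μ (⋃ k ∈ Finset.range (J + 1), T k) :=
          (measure_biUnion_finset hdisj fun k _ => hTm k).symm
      _ ≤ _ := by
          apply measure_mono
          intro p hp
          simp only [mem_iUnion] at hp
          obtain ⟨k, hk, q, hq, rfl⟩ := hp
          apply sgr_of_min w hw hc hS xs M0 hM0 hxs
          intro z hz
          have hk' : (k : ℝ) ≤ J := by
            have := Finset.mem_range.1 hk
            exact_mod_cast Nat.lt_succ_iff.1 this
          have h1 := hq z hz
          have h2 := (abs_le.1 (hBd q hq)).1
          have h3 := hξ z hz
          rw [inner_add_left, real_inner_smul_left]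
          have h4 : inner ℝ q (z - xs) = inner ℝ q (z - g) - inner ℝ q (xs - g) := by
            rw [← inner_sub_right]; congr 1; abel
          have h5 : (k : ℝ) * M0 / D * inner ℝ ξ (z - xs) ≤ M0 / 2 := by
            calc (k : ℝ) * M0 / D * inner ℝ ξ (z - xs) ≤ (k : ℝ) * M0 / D * α := by gcongr
              _ ≤ M0 / 2 := by
                rw [div_mul_eq_mul_div, div_le_iff₀ hd]
                have : 2 * (k : ℝ) * α ≤ D := le_trans (by gcongr) hJ
                nlinarith
          linarith
  · have hsub : Dgr w ((fun z => g + (1 / 2 : ℝ) • (z - g)) '' {y | w y < 0}) ⊆ (16 : ℝ) • B := by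
      intro p hp
      simp only [Dgr, mem_iUnion] at hp
      obtain ⟨_, ⟨z, hz, rfl⟩, hp⟩ := hp
      rw [Set.mem_smul_set_iff_inv_smul_mem₀ (by norm_num)]
      intro z' hz'
      have h1 := hp ((1 / 2 : ℝ) • z + (1 / 2 : ℝ) • z')
      have h2 : w ((1 / 2 : ℝ) • z + (1 / 2 : ℝ) • z') ≤ 0 :=
        hSc (show w z ≤ 0 from le_of_lt hz) hz' (by norm_num) (by norm_num) (by norm_num)
      have h3 := hM (g + (1 / 2 : ℝ) • (z - g))
      have h4 : (1 / 2 : ℝ) • z + (1 / 2 : ℝ) • z' - (g + (1 / 2 : ℝ) • (z - g))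
          = (1 / 2 : ℝ) • (z' - g) := by module
      simp only [h4, inner_smul_right] at h1
      rw [real_inner_smul_left]
      linarith
    calc _ ≤ μ ((16 : ℝ) • B) := measure_mono hsub
      _ = _ := by rw [Measure.addHaar_smul, abs_of_nonneg (by positivity)]

theorem MA_contra (μ : Measure F) [μ.IsAddHaarMeasure] (v : F → ℝ) (hv : ConvexOn ℝ univ v)
    (hc : Continuous v) (h0 : ∀ y, 0 ≤ v y)
    (y0 y1 ξ : F) (hy0 : v y0 = 0) (hy1 : v y1 = 0) (hne : y1 ≠ y0)
    (hξ : ∀ y, v y = 0 → inner ℝ ξ (y - y0) ≤ - ‖y - y0‖ ^ 2 / 2)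
    (r : ℝ) (hr : 0 < r) (Q : ℝ≥0∞) (hQ : Q ≠ ⊤)
    (hD : ∀ S : Set F, IsOpen S → Convex ℝ S → S ⊆ Metric.ball y0 r → ∀ g ∈ S, v g = 0 →
      ∀ lam : F, ∀ κ : ℝ,
      μ (Dgr (fun y => v y - (inner ℝ lam y + κ)) S) ≤ Q *
        μ (Dgr (fun y => v y - (inner ℝ lam y + κ))
          ((fun z => g + (1 / 2 : ℝ) • (z - g)) '' S))) : False := by
  set s1 := - inner ℝ ξ (y1 - y0) with hs1
  have hs1p : 0 < s1 := by
    have h := hξ y1 hy1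
    have : 0 < ‖y1 - y0‖ := norm_pos_iff.2 (sub_ne_zero.2 hne)
    have : 0 < ‖y1 - y0‖ ^ 2 := by positivity
    linarith
  obtain ⟨σ, hσ, hσs, hσr⟩ : ∃ σ : ℝ, 0 < σ ∧ σ ≤ s1 ∧ 2 * σ < r ^ 2 := by
    refine ⟨min s1 (r ^ 2 / 4), by positivity, min_le_left _ _, ?_⟩
    have := min_le_right s1 (r ^ 2 / 4)
    have : 0 < r ^ 2 := by positivity
    linarith
  set d : F := (σ / (2 * s1)) • (y0 - y1) with hdd
  have hξd : inner ℝ ξ d = σ / 2 := by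
    rw [hdd, inner_smul_right, ← neg_sub y1 y0, inner_neg_right, ← hs1]
    field_simp
  have hseg : ∀ t : ℝ, 0 ≤ t → t ≤ 2 → v (y0 - t • d) = 0 := by
    intro t ht0 ht2
    have h1 : 0 ≤ t * (σ / (2 * s1)) := by positivity
    have h2 : t * (σ / (2 * s1)) ≤ 1 := by
      rw [mul_div_assoc', div_le_one (by positivity)]; nlinarith
    have h3 := hv.2 (mem_univ y0) (mem_univ y1) (sub_nonneg.2 h2) h1 (by ring)
    have h4 : y0 - t • d = (1 - t * (σ / (2 * s1))) • y0 + (t * (σ / (2 * s1))) • y1 := by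
      rw [hdd]; module
    rw [← h4, hy0, hy1] at h3
    simp at h3
    exact le_antisymm h3 (h0 _)
  -- main estimate for each J
  have key : ∀ J : ℕ, ((J + 1 : ℕ) : ℝ≥0∞) ≤ Q * ENNReal.ofReal (16 ^ Module.finrank ℝ F) := by
    intro J
    set α := σ / (4 * (J + 1)) with hα
    have hαp : 0 < α := by positivity
    -- choose ε
    set Z : Set F := Metric.closedBall y0 r ∩ {y | -σ ≤ inner ℝ ξ (y - y0)} ∩
      ({y | r ≤ dist y y0} ∪ {y | α ≤ inner ℝ ξ (y - y0)}) with hZ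
    have hZc : IsCompact Z := by
      refine ((isCompact_closedBall y0 r).inter_right ?_).inter_right (IsClosed.union ?_ ?_)
      · exact isClosed_le (by fun_prop) (by fun_prop)
      · exact isClosed_le (by fun_prop) (by fun_prop)
      · exact isClosed_le (by fun_prop) (by fun_prop)
    have hZpos : ∀ y ∈ Z, 0 < v y := by
      rintro y ⟨⟨hy, hy2⟩, hy3⟩
      refine lt_of_le_of_ne (h0 y) fun h => ?_
      have h5 := hξ y h.symm
      simp only [mem_ofPred_eq] at hy2
      rcases hy3 with hy3 | hy3
      · simp only [mem_ofPred_eq, dist_eq_norm] at hy3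
        nlinarith
      · simp only [mem_ofPred_eq] at hy3
        nlinarith [sq_nonneg ‖y - y0‖]
    obtain ⟨δ, hδ, hδZ⟩ : ∃ δ > 0, ∀ y ∈ Z, δ ≤ v y := by
      rcases Z.eq_empty_or_nonempty with h | h
      · exact ⟨1, one_pos, by simp [h]⟩
      · obtain ⟨z, hz, hzm⟩ := hZc.exists_isMinOn h hc.continuousOn
        exact ⟨v z, hZpos z hz, fun y hy => hzm hy⟩
    set ε := δ / (2 * (‖ξ‖ * r + σ)) with hε
    have hεp : 0 < ε := by positivity
    set w : F → ℝ := fun y => v y - (inner ℝ (ε • ξ) y + ε * (σ - inner ℝ ξ y0)) with hw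
    have hwe : ∀ y, w y = v y - ε * (inner ℝ ξ (y - y0) + σ) := by
      intro y; simp only [hw, real_inner_smul_left, inner_sub_right]; ring
    have hwZ : ∀ y ∈ Z, 0 < w y := by
      intro y hy
      rw [hwe]
      have h1 := hδZ y hy
      have h2 : inner ℝ ξ (y - y0) ≤ ‖ξ‖ * r := by
        refine (real_inner_le_norm _ _).trans ?_
        gcongr
        simpa [dist_eq_norm] using hy.1.1
      have h3 : ε * (inner ℝ ξ (y - y0) + σ) ≤ ε * (‖ξ‖ * r + σ) := by gcongr
      have h4 : ε * (‖ξ‖ * r + σ) = δ / 2 := by rw [hε]; field_simp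
      linarith
    have hwc : Continuous w := by simp only [hw]; fun_prop
    have hwcv : ConvexOn ℝ univ w := by
      refine hv.sub (ConcaveOn.add ?_ (concaveOn_const _ convex_univ))
      exact (innerSL ℝ (ε • ξ)).toLinearMap.concaveOn convex_univ
    have hσle : ∀ y, w y ≤ 0 → -σ ≤ inner ℝ ξ (y - y0) := by
      intro y hy
      rw [hwe] at hy
      have := h0 y
      by_contra hcon
      push Not at hcon
      nlinarith
    have hwy0 : w y0 = -(ε * σ) := by rw [hwe, hy0]; simp
    have hball : {y | w y ≤ 0} ⊆ Metric.ball y0 r := by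
      intro z hz
      by_contra hzb
      rw [Metric.mem_ball, not_lt] at hzb
      have hdp : 0 < dist z y0 := lt_of_lt_of_le hr hzb
      set t := r / dist z y0 with ht
      have ht0 : 0 ≤ t := by positivity
      have ht1 : t ≤ 1 := by rw [ht, div_le_one hdp]; exact hzb
      have h1 : w ((1 - t) • y0 + t • z) ≤ 0 := by
        have := hwcv.2 (mem_univ y0) (mem_univ z) (sub_nonneg.2 ht1) ht0 (by ring)
        rw [hwy0] at this
        simp only [smul_eq_mul] at this
        have hz' : w z ≤ 0 := hz
        have : (1 - t) * (-(ε * σ)) ≤ 0 := by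
          have : 0 ≤ (1 - t) * (ε * σ) := mul_nonneg (by linarith) (by positivity)
          linarith
        have : t * w z ≤ 0 := mul_nonpos_of_nonneg_of_nonpos ht0 hz'
        linarith
      have h2 : dist ((1 - t) • y0 + t • z) y0 = r := by
        rw [dist_eq_norm, show (1 - t) • y0 + t • z - y0 = t • (z - y0) by module, norm_smul,
          Real.norm_of_nonneg ht0, ← dist_eq_norm, ht]
        field_simp
      exact absurd (hwZ _ ⟨⟨by simp [h2], hσle _ h1⟩, Or.inl h2.ge⟩) (not_lt.2 h1)
    have hαle : ∀ y, w y ≤ 0 → inner ℝ ξ (y - y0) ≤ α := by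
      intro y hy
      by_contra hcon
      push Not at hcon
      exact absurd (hwZ _ ⟨⟨Metric.ball_subset_closedBall (hball hy), hσle _ hy⟩,
        Or.inr hcon.le⟩) (not_lt.2 hy)
    have hScomp : IsCompact {y | w y ≤ 0} :=
      (isCompact_closedBall y0 r).of_isClosed_subset (isClosed_le hwc continuous_const)
        (hball.trans Metric.ball_subset_closedBall)
    have hασ : α ≤ σ := by
      rw [hα, div_le_iff₀ (by positivity)]
      have : (0 : ℝ) ≤ J := by positivity
      nlinarith
    have hv1 := hseg 1 (by norm_num) (by norm_num)
    rw [one_smul] at hv1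
    have hwg : w (y0 - d) = -(ε * (σ / 2)) := by
      rw [hwe, hv1, show y0 - d - y0 = -d by abel, inner_neg_right, hξd]; ring
    have hwgd : w (y0 - d - (y0 - (y0 - d))) ≤ 0 := by
      rw [show y0 - d - (y0 - (y0 - d)) = y0 - (2 : ℝ) • d by module, hwe,
        hseg 2 (by norm_num) le_rfl, show y0 - (2 : ℝ) • d - y0 = -((2 : ℝ) • d) by abel,
        inner_neg_right, inner_smul_right, hξd]
      apply le_of_eq; ring
    have hyd : inner ℝ ξ (y0 - (y0 - d)) = σ / 2 := by rw [sub_sub_cancel, hξd]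
    obtain ⟨P, hP0, hPt, hlow, hup⟩ := core_MA μ w hwcv hwc hScomp y0 (y0 - d) ξ (ε * σ)
      (ε * (α + σ)) α (by positivity) hwy0
      (by
        intro y
        rcases le_or_gt (w y) 0 with h | h
        · rw [hwe]
          have h1 := hαle y h
          have h2 := h0 y
          have : ε * (inner ℝ ξ (y - y0) + σ) ≤ ε * (α + σ) := by gcongr
          linarith
        · have : 0 < ε * (α + σ) := by positivity
          linarith)
      (by nlinarith) (by rw [hwg]; have : 0 < ε * (σ / 2) := by positivity
                         linarith) hwgd J hαp hαle
      (by
        rw [hyd, hα, mul_div_assoc', div_le_iff₀ (by positivity)]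
        nlinarith)
      (by rw [hyd]; positivity)
    have hdb := hD {y | w y < 0} (isOpen_lt hwc continuous_const) (by simpa using hwcv.convex_lt 0)
      (fun y hy => hball (show w y ≤ 0 from le_of_lt hy)) (y0 - d)
      (by
        show w (y0 - d) < 0
        rw [hwg]; have : 0 < ε * (σ / 2) := by positivity
        linarith) hv1 (ε • ξ) (ε * (σ - inner ℝ ξ y0))
    have hfin : ((J + 1 : ℕ) : ℝ≥0∞) * P ≤ Q * ENNReal.ofReal (16 ^ Module.finrank ℝ F) * P :=
      calc _ ≤ _ := hlow
        _ ≤ _ := hdb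
        _ ≤ Q * (ENNReal.ofReal (16 ^ Module.finrank ℝ F) * P) := by gcongr
        _ = _ := by rw [mul_assoc]
    exact (ENNReal.mul_le_mul_iff_left hP0 hPt).1 hfin
  have hfin : Q * ENNReal.ofReal (16 ^ Module.finrank ℝ F) ≠ ⊤ :=
    ENNReal.mul_ne_top hQ ENNReal.ofReal_ne_top
  obtain ⟨J, hJ⟩ := ENNReal.exists_nat_gt hfin
  have := key J
  have h2 : ((J : ℕ) : ℝ≥0∞) ≤ ((J + 1 : ℕ) : ℝ≥0∞) := by exact_mod_cast Nat.le_succ J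
  exact absurd (hJ.trans_le (h2.trans this)) (lt_irrefl _)

end absMA


section absMA2
open scoped Pointwise
set_option linter.unusedSectionVars false

variable {F : Type*} [NormedAddCommGroup F] [InnerProductSpace ℝ F] [FiniteDimensional ℝ F]
  [MeasurableSpace F] [BorelSpace F]

theorem Dgr_affine (v : F → ℝ) (lam : F) (κ : ℝ) (S : Set F) :
    Dgr (fun y => v y - (inner ℝ lam y + κ)) S = (fun q => q + lam) ⁻¹' Dgr v S := by
  ext q
  simp only [Dgr, sgr, mem_iUnion, mem_preimage, mem_ofPred_eq, inner_add_left, inner_sub_right,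
    exists_prop]
  refine exists_congr fun y => and_congr_right fun _ => forall_congr' fun y' => ?_
  constructor <;> intro h <;> linarith

theorem Dgr_affine_meas (μ : Measure F) [μ.IsAddHaarMeasure] (v : F → ℝ) (lam : F) (κ : ℝ)
    (S : Set F) : μ (Dgr (fun y => v y - (inner ℝ lam y + κ)) S) = μ (Dgr v S) := by
  rw [Dgr_affine, measure_preimage_add_right]

theorem Dgr_mono (v : F → ℝ) {S T : Set F} (h : S ⊆ T) : Dgr v S ⊆ Dgr v T :=
  biUnion_subset_biUnion_left h

/-- the two sided density hypothesis -/
def DensHyp (μ : Measure F) (v : F → ℝ) (p : ℝ) : Prop :=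
  ∀ R : ℝ, ∃ Q : ℝ≥0∞, Q ≠ ⊤ ∧ ∀ ω : Set F, MeasurableSet ω → ω ⊆ Metric.ball 0 R →
    (∀ y ∈ ω, 0 < v y) →
    μ (Dgr v ω) ≤ Q * ∫⁻ y in ω, ENNReal.ofReal (v y ^ (p - 1)) ∂μ ∧
    ∫⁻ y in ω, ENNReal.ofReal (v y ^ (p - 1)) ∂μ ≤ Q * μ (Dgr v ω)

/-- halving map -/
def halfMap (g : F) : F → F := fun z => g + (1 / 2 : ℝ) • (z - g)

theorem halfMap_inj (g : F) : Function.Injective (halfMap g) := by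
  intro a b h
  simpa [halfMap] using h

theorem halfMap_cont (g : F) : Continuous (halfMap g) := by
  unfold halfMap; fun_prop

theorem map_halfMap (μ : Measure F) [μ.IsAddHaarMeasure] (g : F) :
    Measure.map (halfMap g) μ = ENNReal.ofReal (2 ^ Module.finrank ℝ F) • μ := by
  ext s hs
  rw [Measure.map_apply (halfMap_cont g).measurable hs]
  have : halfMap g ⁻¹' s = AffineMap.homothety g (2 : ℝ) '' s := by
    ext z
    simp only [mem_preimage, mem_image, AffineMap.homothety_apply, vsub_eq_sub, vadd_eq_add]
    constructor
    · intro h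
      refine ⟨_, h, ?_⟩
      simp only [halfMap]; module
    · rintro ⟨y, hy, rfl⟩
      convert hy using 1
      simp only [halfMap]; module
  rw [this, Measure.addHaar_image_homothety, abs_of_nonneg (by positivity)]
  rfl

theorem lint_halfMap (μ : Measure F) [μ.IsAddHaarMeasure] (g : F) (ψ : F → ℝ≥0∞)
    (hψ : Measurable ψ) (A : Set F) (hA : MeasurableSet A) :
    ∫⁻ y in A, ψ (halfMap g y) ∂μ =
      ENNReal.ofReal (2 ^ Module.finrank ℝ F) * ∫⁻ y in halfMap g '' A, ψ y ∂μ := by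
  have hm : MeasurableSet (halfMap g '' A) :=
    hA.image_of_continuousOn_injOn (halfMap_cont g).continuousOn (halfMap_inj g).injOn
  have h1 : ∫⁻ y in halfMap g '' A, ψ y ∂(Measure.map (halfMap g) μ) =
      ∫⁻ y in A, ψ (halfMap g y) ∂μ := by
    rw [setLIntegral_map hm hψ (halfMap_cont g).measurable,
      preimage_image_eq _ (halfMap_inj g)]
  rw [← h1, map_halfMap, Measure.restrict_smul, lintegral_smul_measure, smul_eq_mul]

theorem farthest (C : Set F) (hC : IsCompact C) (hne : C.Nonempty) (o : F) :
    ∃ y0 ∈ C, (∀ y ∈ C, ‖y - o‖ ≤ ‖y0 - o‖) ∧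
      ∀ y ∈ C, inner ℝ (y0 - o) (y - y0) ≤ - ‖y - y0‖ ^ 2 / 2 := by
  obtain ⟨y0, hy0, hmax⟩ := hC.exists_isMaxOn hne
    (f := fun y => ‖y - o‖) (by fun_prop)
  refine ⟨y0, hy0, fun y hy => hmax hy, fun y hy => ?_⟩
  have h1 : ‖y - o‖ ≤ ‖y0 - o‖ := hmax hy
  have h2 : ‖y - o‖ ^ 2 ≤ ‖y0 - o‖ ^ 2 := by gcongr
  rw [show y - o = (y - y0) + (y0 - o) by abel, norm_add_sq_real, real_inner_comm] at h2
  linarith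

theorem P1_abs (μ : Measure F) [μ.IsAddHaarMeasure] (v : F → ℝ) (hv : ConvexOn ℝ univ v)
    (hc : Continuous v) (p : ℝ) (hp : p < 1) (hH : DensHyp μ v p) (h0 : ∀ y, 0 ≤ v y)
    (x : F) (c : ℝ) (hx : ∀ y, inner ℝ x y + c ≤ v y)
    (hC : IsCompact {y | v y = inner ℝ x y + c}) (y1 y2 : F) (hne : y1 ≠ y2)
    (hy1 : v y1 = inner ℝ x y1 + c) (hy2 : v y2 = inner ℝ x y2 + c) :
    ∀ y, v y = inner ℝ x y + c → v y = 0 := by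
  intro y3 hy3
  by_contra hy3n
  have hy3p : 0 < v y3 := lt_of_le_of_ne (h0 _) (Ne.symm hy3n)
  obtain ⟨y0, hy0, hv0, ξ, hξ⟩ : ∃ y0, v y0 = inner ℝ x y0 + c ∧ 0 < v y0 ∧ ∃ ξ : F,
      ∀ y, v y = inner ℝ x y + c → inner ℝ ξ (y - y0) ≤ - ‖y - y0‖ ^ 2 / 2 := by
    obtain ⟨B, hBp, hB⟩ : ∃ B > 0, ∀ y, v y = inner ℝ x y + c → ‖y‖ ≤ B := by
      obtain ⟨B, hB⟩ := hC.isBounded.subset_closedBall 0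
      exact ⟨max B 1, by positivity, fun y hy => le_max_of_le_left (by simpa using hB hy)⟩
    set T := B ^ 2 / v y3 with hT
    have hTp : 0 < T := by positivity
    obtain ⟨y0, hy0, hmax, hex⟩ := farthest _ hC ⟨y1, hy1⟩ (-(T • x))
    refine ⟨y0, hy0, ?_, _, fun y hy => hex y hy⟩
    refine lt_of_le_of_ne (h0 _) fun h => ?_
    have h1 := hmax y3 hy3
    have h2 : ‖y3 - -(T • x)‖ ^ 2 ≤ ‖y0 - -(T • x)‖ ^ 2 := by gcongr
    rw [sub_neg_eq_add, sub_neg_eq_add, norm_add_sq_real, norm_add_sq_real, inner_smul_right,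
      inner_smul_right, real_inner_comm x y3, real_inner_comm x y0] at h2
    have hy0' : v y0 = inner ℝ x y0 + c := hy0
    have h3 : inner ℝ x y3 - inner ℝ x y0 = v y3 := by linarith
    have h4 : T * v y3 = B ^ 2 := by rw [hT]; field_simp
    have h5 : ‖y0‖ ^ 2 ≤ B ^ 2 := by gcongr; exact hB _ hy0
    have h6 : T * inner ℝ x y3 - T * inner ℝ x y0 = B ^ 2 := by rw [← mul_sub, h3, h4]
    have : 0 < B ^ 2 := by positivity
    nlinarith [sq_nonneg ‖y3‖]
  obtain ⟨y4, hy4, hy4n⟩ : ∃ y4, v y4 = inner ℝ x y4 + c ∧ y4 ≠ y0 := by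
    by_cases h : y1 = y0
    · exact ⟨y2, hy2, fun h' => hne (h.trans h'.symm)⟩
    · exact ⟨y1, hy1, h⟩
  obtain ⟨r, hr, hrb⟩ : ∃ r > 0, ∀ y ∈ Metric.ball y0 r, v y0 / 2 < v y ∧ v y < 2 * v y0 := by
    have h1 : {y | v y0 / 2 < v y} ∩ {y | v y < 2 * v y0} ∈ nhds y0 := by
      refine ((isOpen_lt (by fun_prop) (by fun_prop)).inter
        (isOpen_lt (by fun_prop) (by fun_prop))).mem_nhds ⟨?_, ?_⟩ <;>
      simp only [mem_ofPred_eq] <;> linarith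
    obtain ⟨r, hr, h⟩ := Metric.mem_nhds_iff.1 h1
    exact ⟨r, hr, fun y hy => h hy⟩
  obtain ⟨Q, hQ, hQH⟩ := hH (‖y0‖ + r)
  have hsub : Metric.ball y0 r ⊆ Metric.ball 0 (‖y0‖ + r) := by
    apply Metric.ball_subset_ball'
    simp [add_comm]
  set Ψ1 := ENNReal.ofReal ((2 * v y0) ^ (p - 1)) with hΨ1
  set Ψ2 := ENNReal.ofReal ((v y0 / 2) ^ (p - 1)) with hΨ2
  have hΨ1p : Ψ1 ≠ 0 := by
    rw [hΨ1]; simp only [ne_eq, ENNReal.ofReal_eq_zero, not_le]; positivity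
  have hb : ∀ y ∈ Metric.ball y0 r, Ψ1 ≤ ENNReal.ofReal (v y ^ (p - 1)) ∧
      ENNReal.ofReal (v y ^ (p - 1)) ≤ Ψ2 := by
    intro y hy
    obtain ⟨h1, h2⟩ := hrb y hy
    exact ⟨ENNReal.ofReal_le_ofReal (Real.rpow_le_rpow_of_nonpos (by linarith) h2.le (by linarith)),
      ENNReal.ofReal_le_ofReal (Real.rpow_le_rpow_of_nonpos (by linarith) h1.le (by linarith))⟩
  set c2 := ENNReal.ofReal (2 ^ Module.finrank ℝ F) with hc2
  refine MA_contra μ (fun y => v y - (inner ℝ x y + c)) ?_ (by fun_prop)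
    (fun y => by linarith [hx y]) y0 y4 ξ (by linarith) (by linarith) hy4n
    (fun y hy => hξ y (by linarith)) r hr (Q * (Ψ2 * (c2 * (Ψ1⁻¹ * Q)))) ?_ ?_
  · refine hv.sub (ConcaveOn.add ?_ (concaveOn_const _ convex_univ))
    exact (innerSL ℝ x).toLinearMap.concaveOn convex_univ
  · refine ENNReal.mul_ne_top hQ (ENNReal.mul_ne_top ENNReal.ofReal_ne_top
      (ENNReal.mul_ne_top ENNReal.ofReal_ne_top (ENNReal.mul_ne_top ?_ hQ)))
    exact ENNReal.inv_ne_top.2 hΨ1p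
  · intro S hSo hSc hSb g hg _ lam κ
    rw [Dgr_affine_meas, Dgr_affine_meas, Dgr_affine_meas, Dgr_affine_meas]
    change μ (Dgr v S) ≤ _ * μ (Dgr v (halfMap g '' S))
    have hhS : halfMap g '' S ⊆ S := by
      rintro _ ⟨z, hz, rfl⟩
      have : halfMap g z = (1 / 2 : ℝ) • g + (1 / 2 : ℝ) • z := by simp only [halfMap]; module
      rw [this]
      exact hSc hg hz (by norm_num) (by norm_num) (by norm_num)
    have hm : MeasurableSet (halfMap g '' S) :=
      hSo.measurableSet.image_of_continuousOn_injOn (halfMap_cont g).continuousOn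
        (halfMap_inj g).injOn
    have hpos : ∀ y ∈ S, 0 < v y := fun y hy => by linarith [(hrb y (hSb hy)).1]
    have e1 := (hQH S hSo.measurableSet (hSb.trans hsub) hpos).1
    have e2 := (hQH (halfMap g '' S) hm ((hhS.trans hSb).trans hsub)
      fun y hy => hpos y (hhS hy)).2
    have e3 : ∫⁻ y in S, ENNReal.ofReal (v y ^ (p - 1)) ∂μ ≤ Ψ2 * μ S := by
      rw [← setLIntegral_const]
      exact setLIntegral_mono' hSo.measurableSet fun y hy => (hb y (hSb hy)).2
    have e4 : Ψ1 * μ (halfMap g '' S) ≤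
        ∫⁻ y in halfMap g '' S, ENNReal.ofReal (v y ^ (p - 1)) ∂μ := by
      rw [← setLIntegral_const]
      exact setLIntegral_mono' hm fun y hy => (hb y (hSb (hhS hy))).1
    have e5 : μ S = c2 * μ (halfMap g '' S) := by
      have := lint_halfMap μ g (fun _ => 1) measurable_const S hSo.measurableSet
      simpa only [setLIntegral_one] using this
    have e6 : μ (halfMap g '' S) ≤ Ψ1⁻¹ * (Q * μ (Dgr v (halfMap g '' S))) := by
      rw [← ENNReal.mul_le_iff_le_inv hΨ1p ENNReal.ofReal_ne_top]
      exact e4.trans e2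
    calc μ (Dgr v S) ≤ Q * (Ψ2 * μ S) := e1.trans (by gcongr)
      _ ≤ Q * (Ψ2 * (c2 * (Ψ1⁻¹ * (Q * μ (Dgr v (halfMap g '' S)))))) := by
          rw [e5]; gcongr
      _ = _ := by ring

theorem P2_abs (μ : Measure F) [μ.IsAddHaarMeasure] (v : F → ℝ) (hv : ConvexOn ℝ univ v)
    (hc : Continuous v) (p : ℝ) (hp : p < 1) (hH : DensHyp μ v p) (h0 : ∀ y, 0 ≤ v y)
    (hC : IsCompact {y | v y = 0}) (y1 y2 : F) (hne : y1 ≠ y2)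
    (hy1 : v y1 = 0) (hy2 : v y2 = 0) (hnull : μ {y | v y = 0} = 0)
    (hD : μ (Dgr v {y | v y = 0}) = 0) : False := by
  obtain ⟨y0, hy0, hmax, hex⟩ := farthest _ hC ⟨y1, hy1⟩ y1
  have hne' : y1 ≠ y0 := by
    rintro rfl
    have := hmax y2 hy2
    simp at this
    exact hne (sub_eq_zero.1 this).symm
  obtain ⟨Q, hQ, hQH⟩ := hH (‖y0‖ + 1)
  have hsub : Metric.ball y0 1 ⊆ Metric.ball 0 (‖y0‖ + 1) := by
    apply Metric.ball_subset_ball'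
    simp [add_comm]
  set c2 := ENNReal.ofReal (2 ^ Module.finrank ℝ F) with hc2
  have hψm : Measurable (fun y => ENNReal.ofReal (v y ^ (p - 1))) := by
    have := hc.measurable
    fun_prop
  refine MA_contra μ v hv hc h0 y0 y1 (y0 - y1) hy0 hy1 hne' (fun y hy => hex y hy) 1 one_pos
    (Q * (c2 * Q)) (ENNReal.mul_ne_top hQ (ENNReal.mul_ne_top ENNReal.ofReal_ne_top hQ)) ?_
  intro S hSo hSc hSb g hg hvg lam κ
  rw [Dgr_affine_meas, Dgr_affine_meas]
  change μ (Dgr v S) ≤ _ * μ (Dgr v (halfMap g '' S))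
  have hhe : ∀ z, halfMap g z = (1 / 2 : ℝ) • g + (1 / 2 : ℝ) • z := fun z => by
    simp only [halfMap]; module
  have hhS : halfMap g '' S ⊆ S := by
    rintro _ ⟨z, hz, rfl⟩
    rw [hhe]
    exact hSc hg hz (by norm_num) (by norm_num) (by norm_num)
  have hhv : ∀ z, v (halfMap g z) ≤ v z := by
    intro z
    have := hv.2 (mem_univ g) (mem_univ z) (by norm_num : (0 : ℝ) ≤ 1 / 2)
      (by norm_num : (0 : ℝ) ≤ 1 / 2) (by norm_num)
    rw [← hhe, hvg] at this
    simp only [smul_eq_mul] at this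
    have := h0 z
    linarith
  set C := {y | v y = 0} with hCdef
  have hCm : MeasurableSet C := hC.measurableSet
  set A := S \ halfMap g ⁻¹' C with hA
  have hpre : MeasurableSet (halfMap g ⁻¹' C) := (halfMap_cont g).measurable hCm
  have hAm : MeasurableSet A := hSo.measurableSet.diff hpre
  have hprenull : μ (halfMap g ⁻¹' C) = 0 := by
    rw [← Measure.map_apply (halfMap_cont g).measurable hCm, map_halfMap]
    simp [hnull]
  have hAim : MeasurableSet (halfMap g '' A) :=
    hAm.image_of_continuousOn_injOn (halfMap_cont g).continuousOn (halfMap_inj g).injOn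
  have hAimS : halfMap g '' A ⊆ S := (image_mono sdiff_subset).trans hhS
  have e1 := (hQH (S \ C) (hSo.measurableSet.diff hCm) ((sdiff_subset.trans hSb).trans hsub)
    fun y hy => lt_of_le_of_ne (h0 y) fun h => hy.2 h.symm).1
  have e2 := (hQH (halfMap g '' A) hAim ((hAimS.trans hSb).trans hsub) (by
    rintro _ ⟨z, hz, rfl⟩
    exact lt_of_le_of_ne (h0 _) fun h => hz.2 h.symm)).2
  have e3 : ∫⁻ y in S \ C, ENNReal.ofReal (v y ^ (p - 1)) ∂μ ≤
      ∫⁻ y in A, ENNReal.ofReal (v y ^ (p - 1)) ∂μ := by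
    have h1 : S \ C ⊆ A ∪ halfMap g ⁻¹' C := by
      intro y hy
      by_cases h : y ∈ halfMap g ⁻¹' C
      · exact Or.inr h
      · exact Or.inl ⟨hy.1, h⟩
    calc _ ≤ ∫⁻ y in A ∪ halfMap g ⁻¹' C, ENNReal.ofReal (v y ^ (p - 1)) ∂μ :=
          lintegral_mono_set h1
      _ ≤ _ := lintegral_union_le _ _ _
      _ = _ := by rw [setLIntegral_measure_zero _ _ hprenull, add_zero]
  have e4 : ∫⁻ y in A, ENNReal.ofReal (v y ^ (p - 1)) ∂μ ≤
      ∫⁻ y in A, ENNReal.ofReal (v (halfMap g y) ^ (p - 1)) ∂μ := by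
    refine setLIntegral_mono' hAm fun y hy => ENNReal.ofReal_le_ofReal ?_
    refine Real.rpow_le_rpow_of_nonpos ?_ (hhv y) (by linarith)
    exact lt_of_le_of_ne (h0 _) fun h => hy.2 h.symm
  rw [lint_halfMap μ g _ hψm A hAm] at e4
  calc μ (Dgr v S) ≤ μ (Dgr v (S \ C) ∪ Dgr v C) := by
        apply measure_mono
        rw [Dgr, Dgr, Dgr, ← biUnion_union]
        exact biUnion_subset_biUnion_left (by simp)
    _ ≤ μ (Dgr v (S \ C)) := (measure_union_le _ _).trans (by rw [hD, add_zero])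
    _ ≤ Q * (c2 * (Q * μ (Dgr v (halfMap g '' A)))) := by
        refine e1.trans ?_
        gcongr
        refine (e3.trans e4).trans ?_
        gcongr
    _ ≤ Q * (c2 * (Q * μ (Dgr v (halfMap g '' S)))) := by
        gcongr
        exact Dgr_mono v (image_mono sdiff_subset)
    _ = _ := by ring

theorem box_scale (μ : Measure F) [μ.IsAddHaarMeasure] {ι : Type*} [Fintype ι] [DecidableEq ι]
    (Ψ : F ≃ₗ[ℝ] (ι → ℝ)) (d : ι → ℝ) (hd : ∀ i, 0 < d i) :
    μ {y | ∀ i, |Ψ y i| < d i} = ENNReal.ofReal (∏ i, d i) * μ {y | ∀ i, |Ψ y i| < 1} := by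
  set A : F →ₗ[ℝ] F := (Ψ.symm : (ι → ℝ) →ₗ[ℝ] F) ∘ₗ (Matrix.toLin' (Matrix.diagonal d)) ∘ₗ
    (Ψ : F →ₗ[ℝ] (ι → ℝ)) with hA
  have hdet : LinearMap.det A = ∏ i, d i := by
    have := LinearMap.det_conj (Matrix.toLin' (Matrix.diagonal d)) Ψ.symm
    rw [LinearMap.det_toLin', Matrix.det_diagonal] at this
    rw [← this]; rfl
  have hAΨ : ∀ y i, Ψ (A y) i = d i * Ψ y i := by
    intro y i
    simp [hA, Matrix.mulVec_diagonal]
  have himg : {y | ∀ i, |Ψ y i| < d i} = A '' {y | ∀ i, |Ψ y i| < 1} := by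
    ext y
    constructor
    · intro hy
      refine ⟨Ψ.symm (fun i => Ψ y i / d i), fun i => ?_, ?_⟩
      · simp only [LinearEquiv.apply_symm_apply]
        rw [abs_div, abs_of_pos (hd i), div_lt_one (hd i)]
        exact hy i
      · apply Ψ.injective
        ext i
        rw [hAΨ]
        simp only [LinearEquiv.apply_symm_apply]
        have := (hd i).ne'
        field_simp
    · rintro ⟨z, hz, rfl⟩ i
      rw [hAΨ, abs_mul, abs_of_pos (hd i)]
      have := hz i
      have := hd i
      nlinarith
  rw [himg, Measure.addHaar_image_linearMap, hdet,
    abs_of_pos (Finset.prod_pos fun i _ => hd i)]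

theorem box_fin (μ : Measure F) [μ.IsAddHaarMeasure] {ι : Type*} [Fintype ι]
    (Ψ : F ≃ₗ[ℝ] (ι → ℝ)) :
    IsOpen {y | ∀ i, |Ψ y i| < 1} ∧ μ {y | ∀ i, |Ψ y i| < 1} ≠ 0 ∧
    μ {y | ∀ i, |Ψ y i| < 1} ≠ ⊤ := by
  have hcont : Continuous Ψ := Ψ.toContinuousLinearEquiv.continuous
  have hopen : IsOpen {y | ∀ i, |Ψ y i| < 1} := by
    have : {y | ∀ i, |Ψ y i| < 1} = ⋂ i, {y | |Ψ y i| < 1} := by ext; simp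
    rw [this]
    exact isOpen_iInter_of_finite fun i => isOpen_lt (by fun_prop) (by fun_prop)
  refine ⟨hopen, (hopen.measure_pos μ ⟨0, by simp⟩).ne', ?_⟩
  have hcomp : IsCompact (Ψ.toContinuousLinearEquiv.symm '' Metric.closedBall (0 : ι → ℝ) 1) :=
    (isCompact_closedBall _ _).image Ψ.toContinuousLinearEquiv.symm.continuous
  refine ((measure_mono ?_).trans_lt hcomp.measure_lt_top).ne
  intro y hy
  refine ⟨Ψ y, ?_, Ψ.toContinuousLinearEquiv.symm_apply_apply y⟩
  rw [mem_closedBall_zero_iff, pi_norm_le_iff_of_nonneg zero_le_one]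
  exact fun i => (hy i).le

end absMA2


section absMA3
set_option linter.unusedSectionVars false

variable {F : Type*} [NormedAddCommGroup F] [InnerProductSpace ℝ F] [FiniteDimensional ℝ F]
  [MeasurableSpace F] [BorelSpace F]

theorem P3_abs (μ : Measure F) [μ.IsAddHaarMeasure] (v : F → ℝ)
    (hc : Continuous v) (p : ℝ) (hp : p < 1) (hH : DensHyp μ v p) (h0 : ∀ y, 0 ≤ v y)
    (L : ℝ) (hL : 0 < L) (hLip : ∀ y y', v y' ≤ v y + L * ‖y' - y‖)
    (hm : Module.finrank ℝ F ≤ 4) (hnull : μ {y | v y = 0} = 0)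
    (c : F) (a : Fin 2 → F) (ha : LinearIndependent ℝ a)
    (hz : ∀ t : Fin 2 → ℝ, (∀ i, |t i| ≤ 1) → v (c + ∑ i, t i • a i) = 0) : False := by
  classical
  obtain ⟨κ, _, b, hbl⟩ : ∃ (κ : Type _) (_ : Fintype κ) (b : Module.Basis (Fin 2 ⊕ κ) ℝ F),
      ∀ i, b (Sum.inl i) = a i := by
    haveI : Fintype (Fin 2 ⊕ Module.Basis.sumExtendIndex ha) :=
      FiniteDimensional.fintypeBasisIndex (Module.Basis.sumExtend ha)
    haveI : Fintype (Module.Basis.sumExtendIndex ha) :=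
      Fintype.ofInjective (Sum.inr : _ → Fin 2 ⊕ Module.Basis.sumExtendIndex ha) Sum.inr_injective
    refine ⟨Module.Basis.sumExtendIndex ha, inferInstance, Module.Basis.sumExtend ha, fun i => ?_⟩
    simp [Module.Basis.sumExtend]
    rfl
  have hcard : Fintype.card κ ≤ 2 := by
    have h1 := Module.finrank_eq_card_basis b
    rw [Fintype.card_sum, Fintype.card_fin] at h1
    omega
  -- dual coordinates
  obtain ⟨Φ, hΦ⟩ : ∃ Φ : F ≃ₗ[ℝ] (Fin 2 ⊕ κ → ℝ), ∀ q i, Φ q i = inner ℝ q (b i) := by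
    set φ : F →ₗ[ℝ] (Fin 2 ⊕ κ → ℝ) :=
      LinearMap.pi fun i => ((innerSL ℝ (b i)).toLinearMap) with hφ
    have hφa : ∀ q i, φ q i = inner ℝ q (b i) := fun q i => by
      simp [hφ, real_inner_comm]
    have hinj : Function.Injective φ := by
      rw [injective_iff_map_eq_zero]
      intro q hq
      refine InnerProductSpace.ext_inner_right_basis b (fun i => ?_)
      rw [← hφa, hq]; simp
    refine ⟨φ.linearEquivOfInjective hinj ?_, fun q i => hφa q i⟩
    rw [Module.finrank_fintype_fun_eq_card, Module.finrank_eq_card_basis b]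
  set Ψ := b.equivFun with hΨ
  set N := ∑ i, ‖b i‖ with hN
  set Λ := L * N + L with hΛ
  have hN0 : 0 ≤ N := Finset.sum_nonneg fun i _ => norm_nonneg _
  have hbN : ∀ i, ‖b i‖ ≤ N := fun i =>
    Finset.single_le_sum (f := fun i => ‖b i‖) (fun i _ => norm_nonneg _) (Finset.mem_univ i)
  have hΛp : 0 < Λ := by positivity
  obtain ⟨Q, hQ, hQH⟩ := hH (‖c‖ + N + 1)
  obtain ⟨hUo, hU0, hUt⟩ := box_fin μ Ψ
  obtain ⟨hVo, hV0, hVt⟩ := box_fin μ Φ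
  set U := μ {y | ∀ i, |Ψ y i| < 1} with hU
  set V := μ {y | ∀ i, |Φ y i| < 1} with hV
  have key : ∀ δ : ℝ, 0 < δ → δ < 1 →
      ENNReal.ofReal ((Λ * δ) ^ (p - 1)) * ENNReal.ofReal ((1 / 2) ^ 2) * U ≤
        Q * (ENNReal.ofReal ((4 * Λ) ^ 2 * (4 * Λ) ^ Fintype.card κ) * V) := by
    intro δ hδ hδ1
    set d1 : Fin 2 ⊕ κ → ℝ := Sum.elim (fun _ => 1 / 2) (fun _ => δ) with hd1
    set d2 : Fin 2 ⊕ κ → ℝ := Sum.elim (fun _ => 4 * Λ * δ) (fun _ => 4 * Λ) with hd2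
    have hd1p : ∀ i, 0 < d1 i := by rintro (i | i) <;> simp [hd1, hδ]
    have hd2p : ∀ i, 0 < d2 i := by
      rintro (i | i) <;> simp only [hd2, Sum.elim_inl, Sum.elim_inr] <;> positivity
    have hs1 := box_scale μ Ψ d1 hd1p
    have hs2 := box_scale μ Φ d2 hd2p
    rw [Fintype.prod_sum_type] at hs1 hs2
    simp only [hd1, hd2, Sum.elim_inl, Sum.elim_inr, Finset.prod_const, Finset.card_univ,
      Fintype.card_fin] at hs1 hs2
    rw [← hd1, ← hU] at hs1
    rw [← hd2, ← hV] at hs2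
    set B : Set F := (fun y => -c + y) ⁻¹' {y | ∀ i, |Ψ y i| < d1 i} with hB
    have hBm : MeasurableSet B := by
      have hcont : Continuous Ψ := Ψ.toContinuousLinearEquiv.continuous
      have h1 : IsOpen {y | ∀ i, |Ψ y i| < d1 i} := by
        have : {y | ∀ i, |Ψ y i| < d1 i} = ⋂ i, {y | |Ψ y i| < d1 i} := by ext; simp
        rw [this]
        exact isOpen_iInter_of_finite fun i => isOpen_lt (by fun_prop) (by fun_prop)
      exact (h1.preimage (by fun_prop)).measurableSet
    have hBμ : μ B = ENNReal.ofReal ((1 / 2) ^ 2 * δ ^ Fintype.card κ) * U := by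
      rw [hB, measure_preimage_add, hs1]
    -- bound for v
    have hvb : ∀ t : Fin 2 ⊕ κ → ℝ, (∀ i, |t (Sum.inl i)| ≤ 1) → (∀ i, |t (Sum.inr i)| ≤ δ) →
        v (c + ∑ i, t i • b i) ≤ Λ * δ := by
      intro t ht1 ht2
      have h1 := hz (fun i => t (Sum.inl i)) ht1
      have h2 := hLip (c + ∑ i, t (Sum.inl i) • a i) (c + ∑ i, t i • b i)
      have h3 : c + ∑ i, t i • b i - (c + ∑ i, t (Sum.inl i) • a i) =
          ∑ i : κ, t (Sum.inr i) • b (Sum.inr i) := by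
        rw [Fintype.sum_sum_type]
        simp only [hbl]
        abel
      rw [h3, h1] at h2
      have h4 : ‖∑ i : κ, t (Sum.inr i) • b (Sum.inr i)‖ ≤ δ * N := by
        refine (norm_sum_le _ _).trans ?_
        rw [hN, Fintype.sum_sum_type, mul_add, Finset.mul_sum Finset.univ (fun i : κ => _)]
        have : 0 ≤ δ * ∑ i : Fin 2, ‖b (Sum.inl i)‖ := by positivity
        have h5 : ∑ i : κ, ‖t (Sum.inr i) • b (Sum.inr i)‖ ≤ ∑ i : κ, δ * ‖b (Sum.inr i)‖ := by
          refine Finset.sum_le_sum fun i _ => ?_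
          rw [norm_smul]
          gcongr
          exact ht2 i
        linarith
      have h6 : L * ‖∑ i : κ, t (Sum.inr i) • b (Sum.inr i)‖ ≤ L * (δ * N) := by gcongr
      rw [hΛ]
      nlinarith
    have hBrep : ∀ y, y = c + ∑ i, Ψ (-c + y) i • b i := by
      intro y
      rw [hΨ, b.sum_equivFun]; abel
    have hBl : ∀ y ∈ B, ∀ i, |Ψ (-c + y) (Sum.inl i)| < 1 / 2 := fun y hy i => hy (Sum.inl i)
    have hBr : ∀ y ∈ B, ∀ i, |Ψ (-c + y) (Sum.inr i)| < δ := fun y hy i => hy (Sum.inr i)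
    have hvB : ∀ y ∈ B, v y ≤ Λ * δ := by
      intro y hy
      rw [hBrep y]
      exact hvb _ (fun i => (hBl y hy i).le.trans (by norm_num)) fun i => (hBr y hy i).le
    have hBball : B ⊆ Metric.ball 0 (‖c‖ + N + 1) := by
      intro y hy
      rw [mem_ball_zero_iff]
      have h1 : ‖∑ i, Ψ (-c + y) i • b i‖ ≤ N := by
        refine (norm_sum_le _ _).trans ?_
        refine Finset.sum_le_sum fun i _ => ?_
        rw [norm_smul]
        have : ‖Ψ (-c + y) i‖ ≤ 1 := by
          rcases i with i | i
          · exact (hBl y hy i).le.trans (by norm_num)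
          · exact (hBr y hy i).le.trans hδ1.le
        nlinarith [norm_nonneg (b i)]
      have h2 := norm_add_le c (∑ i, Ψ (-c + y) i • b i)
      rw [← hBrep y] at h2
      linarith
    -- subgradients
    have hD : Dgr v B ⊆ {q | ∀ i, |Φ q i| < d2 i} := by
      intro q hq
      simp only [Dgr, mem_iUnion] at hq
      obtain ⟨y, hy, hq⟩ := hq
      rintro (i | i)
      · simp only [hΦ, hd2, Sum.elim_inl]
        have hs : ∀ s : ℝ, |s| ≤ 1 / 2 → s * inner ℝ q (b (Sum.inl i)) ≤ Λ * δ := by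
          intro s hs
          have h1 := hq (y + s • b (Sum.inl i))
          rw [add_sub_cancel_left, inner_smul_right] at h1
          have h2 : v (y + s • b (Sum.inl i)) ≤ Λ * δ := by
            have h3 : y + s • b (Sum.inl i) =
                c + ∑ j, (Ψ (-c + y) j + if j = Sum.inl i then s else 0) • b j := by
              simp only [add_smul, Finset.sum_add_distrib, ite_smul, zero_smul,
                Finset.sum_ite_eq', Finset.mem_univ, if_true]
              rw [← add_assoc, ← hBrep y]
            rw [h3]
            apply hvb
            · intro j
              have h4 := hBl y hy j
              have h5 : |if (Sum.inl j : Fin 2 ⊕ κ) = Sum.inl i then s else 0| ≤ 1 / 2 := by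
                split_ifs
                · exact hs
                · simp
              refine (abs_add_le _ _).trans ?_
              linarith
            · intro j
              simpa using (hBr y hy j).le
          have := h0 y
          linarith
        have h1 := hs (1 / 2) (by norm_num [abs_of_pos])
        have h2 := hs (-(1 / 2)) (by norm_num [abs_of_pos])
        have : 0 < Λ * δ := by positivity
        rw [abs_lt]; constructor <;> linarith
      · simp only [hΦ, hd2, Sum.elim_inr]
        have hs : ∀ s : ℝ, |s| ≤ 1 → s * inner ℝ q (b (Sum.inr i)) ≤ Λ := by
          intro s hs
          have h1 := hq (y + s • b (Sum.inr i))
          have h2 := hLip y (y + s • b (Sum.inr i))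
          rw [add_sub_cancel_left] at h1 h2
          rw [inner_smul_right] at h1
          rw [norm_smul] at h2
          have h3 : ‖s‖ * ‖b (Sum.inr i)‖ ≤ 1 * N := by
            gcongr
            · exact hs
            · exact hbN _
          have h4 : L * (‖s‖ * ‖b (Sum.inr i)‖) ≤ L * (1 * N) := by gcongr
          linarith
        have h1 := hs 1 (by simp)
        have h2 := hs (-1) (by simp)
        rw [abs_lt]; constructor <;> linarith
    set Z := {y | v y = 0} with hZ
    have hZm : MeasurableSet Z := (isClosed_eq hc continuous_const).measurableSet
    have e1 := (hQH (B \ Z) (hBm.diff hZm) (sdiff_subset.trans hBball)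
      fun y hy => lt_of_le_of_ne (h0 y) fun h => hy.2 h.symm).2
    have e2 : ENNReal.ofReal ((Λ * δ) ^ (p - 1)) * μ (B \ Z) ≤
        ∫⁻ y in B \ Z, ENNReal.ofReal (v y ^ (p - 1)) ∂μ := by
      rw [← setLIntegral_const]
      refine setLIntegral_mono' (hBm.diff hZm) fun y hy => ENNReal.ofReal_le_ofReal ?_
      refine Real.rpow_le_rpow_of_nonpos ?_ (hvB y hy.1) (by linarith)
      exact lt_of_le_of_ne (h0 _) fun h => hy.2 h.symm
    have e3 : μ (B \ Z) = μ B := measure_sdiff_null hnull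
    have e4 : μ (Dgr v (B \ Z)) ≤ ENNReal.ofReal ((4 * Λ * δ) ^ 2 * (4 * Λ) ^ Fintype.card κ) * V := by
      rw [← hs2]
      exact measure_mono ((Dgr_mono v sdiff_subset).trans hD)
    have hδ2 : δ ^ 2 ≤ δ ^ Fintype.card κ := pow_le_pow_of_le_one hδ.le hδ1.le hcard
    have e5 : ENNReal.ofReal (δ ^ 2) * (ENNReal.ofReal ((Λ * δ) ^ (p - 1)) *
        ENNReal.ofReal ((1 / 2) ^ 2) * U) ≤ ENNReal.ofReal (δ ^ 2) *
        (Q * (ENNReal.ofReal ((4 * Λ) ^ 2 * (4 * Λ) ^ Fintype.card κ) * V)) := by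
      calc _ = ENNReal.ofReal ((Λ * δ) ^ (p - 1)) * ((ENNReal.ofReal ((1 / 2) ^ 2) *
              ENNReal.ofReal (δ ^ 2)) * U) := by ring
        _ ≤ ENNReal.ofReal ((Λ * δ) ^ (p - 1)) * ((ENNReal.ofReal ((1 / 2) ^ 2) *
              ENNReal.ofReal (δ ^ Fintype.card κ)) * U) := by gcongr
        _ = ENNReal.ofReal ((Λ * δ) ^ (p - 1)) * μ (B \ Z) := by
              rw [e3, hBμ, ENNReal.ofReal_mul (by positivity)]
        _ ≤ Q * (ENNReal.ofReal ((4 * Λ * δ) ^ 2 * (4 * Λ) ^ Fintype.card κ) * V) :=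
              (e2.trans e1).trans (by gcongr)
        _ = _ := by
              rw [show (4 * Λ * δ) ^ 2 * (4 * Λ) ^ Fintype.card κ =
                δ ^ 2 * ((4 * Λ) ^ 2 * (4 * Λ) ^ Fintype.card κ) by ring,
                ENNReal.ofReal_mul (by positivity)]
              ring
    refine (ENNReal.mul_le_mul_iff_right ?_ ENNReal.ofReal_ne_top).1 e5
    simp only [ne_eq, ENNReal.ofReal_eq_zero, not_le]; positivity
  set X := Q * (ENNReal.ofReal ((4 * Λ) ^ 2 * (4 * Λ) ^ Fintype.card κ) * V) with hX
  have hXt : X ≠ ⊤ := ENNReal.mul_ne_top hQ (ENNReal.mul_ne_top ENNReal.ofReal_ne_top hVt)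
  set Y := ENNReal.ofReal ((1 / 2) ^ 2) * U with hY
  have hY0 : Y ≠ 0 := mul_ne_zero (by simp) hU0
  have hXY : X / Y ≠ ⊤ := ENNReal.div_ne_top hXt hY0
  have hYt : Y ≠ ⊤ := ENNReal.mul_ne_top ENNReal.ofReal_ne_top hUt
  have hten := tendsto_rpow_neg_nhdsGT_zero (y := p - 1) (by linarith)
  have hev := (hten.eventually_gt_atTop (X / Y).toReal).and
    (Ioo_mem_nhdsGT (show (0 : ℝ) < Λ from hΛp))
  obtain ⟨t, ht1, ht0, htΛ⟩ := hev.exists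
  have hk := key (t / Λ) (by positivity) (by rw [div_lt_one hΛp]; exact htΛ)
  rw [mul_div_cancel₀ _ hΛp.ne', mul_assoc, ← hY] at hk
  have h1 : ENNReal.ofReal (t ^ (p - 1)) ≤ X / Y := by
    rwa [ENNReal.le_div_iff_mul_le (Or.inl hY0) (Or.inl hYt)]
  have h2 := ENNReal.toReal_mono hXY h1
  rw [ENNReal.toReal_ofReal (by positivity)] at h2
  linarith

end absMA3


section suppBasics

variable {n : ℕ} {K : Set (EuclideanSpace ℝ (Fin n))}

theorem supp_bdd (hK : IsCompact K) (u : EuclideanSpace ℝ (Fin n)) :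
    BddAbove ((fun y => ⟪u, y⟫) '' K) :=
  (hK.image (by fun_prop)).bddAbove

theorem le_supp (hK : IsCompact K) (u : EuclideanSpace ℝ (Fin n)) {z : EuclideanSpace ℝ (Fin n)}
    (hz : z ∈ K) : ⟪u, z⟫ ≤ suppFn K u :=
  le_csSup (supp_bdd hK u) ⟨z, hz, rfl⟩

theorem supp_att (hK : IsCompact K) (hne : K.Nonempty) (u : EuclideanSpace ℝ (Fin n)) :
    ∃ z ∈ K, ⟪u, z⟫ = suppFn K u := by
  have h := (hK.image (f := fun y => ⟪u, y⟫) (by fun_prop)).sSup_mem (hne.image _)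
  obtain ⟨z, hz, h⟩ := h
  exact ⟨z, hz, h⟩

theorem supp_smul (hK : IsCompact K) (hne : K.Nonempty) (u : EuclideanSpace ℝ (Fin n)) (t : ℝ)
    (ht : 0 ≤ t) : suppFn K (t • u) = t * suppFn K u := by
  apply le_antisymm
  · obtain ⟨z, hz, h⟩ := supp_att hK hne (t • u)
    rw [← h, real_inner_smul_left]
    exact mul_le_mul_of_nonneg_left (le_supp hK u hz) ht
  · obtain ⟨z, hz, h⟩ := supp_att hK hne u
    rw [← h, ← real_inner_smul_left]
    exact le_supp hK _ hz

theorem face_smul (hK : IsCompact K) (hne : K.Nonempty) (u : EuclideanSpace ℝ (Fin n)) (t : ℝ)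
    (ht : 0 < t) : face K (t • u) = face K u := by
  ext z
  simp only [face, mem_ofPred_eq, supp_smul hK hne u t ht.le, real_inner_smul_right,
    mul_right_inj' ht.ne']

theorem mem_normalCone_iff (hK : IsCompact K) (u z : EuclideanSpace ℝ (Fin n)) (hz : z ∈ K) :
    u ∈ normalCone K z ↔ suppFn K u = ⟪u, z⟫ := by
  constructor
  · intro h
    refine le_antisymm ?_ (le_supp hK u hz)
    obtain ⟨y, hy, h1⟩ := supp_att hK ⟨z, hz⟩ u
    rw [← h1]; exact h y hy
  · intro h y hy
    rw [← h]; exact le_supp hK u hy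

theorem supp_lip (hK : IsCompact K) (hne : K.Nonempty) (L : ℝ) (hL : ∀ z ∈ K, ‖z‖ ≤ L)
    (u u' : EuclideanSpace ℝ (Fin n)) : suppFn K u' ≤ suppFn K u + L * ‖u' - u‖ := by
  obtain ⟨z, hz, h⟩ := supp_att hK hne u'
  have h1 := le_supp hK u hz
  have h2 := real_inner_le_norm (u' - u) z
  rw [inner_sub_left] at h2
  have h3 : ‖u' - u‖ * ‖z‖ ≤ ‖u' - u‖ * L := by gcongr; exact hL z hz
  linarith [mul_comm L ‖u' - u‖]

theorem supp_convex (hK : IsCompact K) (hne : K.Nonempty) : ConvexOn ℝ univ (suppFn K) := by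
  refine ⟨convex_univ, fun x _ y _ a b ha hb _ => ?_⟩
  obtain ⟨z, hz, h⟩ := supp_att hK hne (a • x + b • y)
  rw [← h, inner_add_left, real_inner_smul_left, real_inner_smul_left]
  simp only [smul_eq_mul]
  gcongr
  · exact le_supp hK x hz
  · exact le_supp hK y hz

theorem supp_cont (hK : IsCompact K) (hne : K.Nonempty) : Continuous (suppFn K) := by
  obtain ⟨L, hL⟩ := hK.isBounded.exists_norm_le
  have hL0 : 0 ≤ L := (norm_nonneg _).trans (hL _ hne.some_mem)
  refine (LipschitzWith.of_dist_le_mul (K := L.toNNReal) fun u u' => ?_).continuous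
  rw [Real.dist_eq, dist_eq_norm, Real.coe_toNNReal _ hL0, abs_le]
  have h1 := supp_lip hK hne L hL u u'
  have h2 := supp_lip hK hne L hL u' u
  rw [norm_sub_rev] at h1
  constructor <;> linarith

end suppBasics

section hausd

variable {X Y : Type*} [MetricSpace X] [MetricSpace Y] [MeasurableSpace X] [BorelSpace X]
  [MeasurableSpace Y] [BorelSpace Y]

theorem haus_lip (d : ℝ) (hd : 0 ≤ d) (f : X → Y) (s : Set X) (C : ℝ) (hC : 0 ≤ C)
    (h : ∀ x ∈ s, ∀ y ∈ s, dist (f x) (f y) ≤ C * dist x y) :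
    μH[d] (f '' s) ≤ ENNReal.ofReal C ^ d * μH[d] s := by
  have : LipschitzOnWith C.toNNReal f s := by
    refine LipschitzOnWith.of_dist_le_mul fun x hx y hy => ?_
    rw [Real.coe_toNNReal _ hC]
    exact h x hx y hy
  exact this.hausdorffMeasure_image_le hd

theorem haus_alip (d : ℝ) (hd : 0 ≤ d) (f : X → Y) (s : Set X) (C : ℝ) (hC : 0 ≤ C)
    (h : ∀ x ∈ s, ∀ y ∈ s, dist x y ≤ C * dist (f x) (f y)) :
    μH[d] s ≤ ENNReal.ofReal C ^ d * μH[d] (f '' s) := by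
  rcases s.eq_empty_or_nonempty with rfl | ⟨x0, hx0⟩
  · simp
  haveI : Nonempty X := ⟨x0⟩
  have hinj : InjOn f s := by
    intro x hx y hy hxy
    have := h x hx y hy
    rw [hxy, dist_self, mul_zero] at this
    exact dist_le_zero.1 this
  have hl := hinj.leftInvOn_invFunOn
  have := haus_lip d hd (Function.invFunOn f s) (f '' s) C hC (by
    rintro _ ⟨x, hx, rfl⟩ _ ⟨y, hy, rfl⟩
    rw [hl hx, hl hy]
    exact h x hx y hy)
  rwa [hl.image_image] at this

theorem lint_img_le (d : ℝ) (G : X → Y) (hG : Measurable G) (ω : Set X)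
    (hω' : MeasurableSet (G '' ω)) (C : ℝ≥0∞)
    (h : ∀ s ⊆ ω, μH[d] (G '' s) ≤ C * μH[d] s) (φ : Y → ℝ≥0∞) (hφ : Measurable φ)
    (hω : MeasurableSet ω) :
    ∫⁻ u in G '' ω, φ u ∂μH[d] ≤ C * ∫⁻ y in ω, φ (G y) ∂μH[d] := by
  rw [← lintegral_map hφ hG, ← smul_eq_mul, ← lintegral_smul_measure]
  refine lintegral_mono' ?_ le_rfl
  refine Measure.le_iff.2 fun A hA => ?_
  rw [Measure.restrict_apply hA, Measure.smul_apply, Measure.map_apply hG hA,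
    Measure.restrict_apply (hG hA), smul_eq_mul]
  have : A ∩ G '' ω = G '' (G ⁻¹' A ∩ ω) := by
    rw [inter_comm A, inter_comm (G ⁻¹' A), image_inter_preimage]
  rw [this]
  exact h _ inter_subset_right

theorem lint_img_ge (d : ℝ) (G : X → Y) (hG : Measurable G) (ω : Set X) (C : ℝ≥0∞)
    (h : ∀ s ⊆ ω, μH[d] s ≤ C * μH[d] (G '' s)) (φ : Y → ℝ≥0∞) (hφ : Measurable φ)
    (hω : MeasurableSet ω) :
    ∫⁻ y in ω, φ (G y) ∂μH[d] ≤ C * ∫⁻ u in G '' ω, φ u ∂μH[d] := by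
  rw [← lintegral_map hφ hG, ← smul_eq_mul, ← lintegral_smul_measure]
  refine lintegral_mono' ?_ le_rfl
  refine Measure.le_iff.2 fun A hA => ?_
  rw [Measure.smul_apply, Measure.map_apply hG hA, Measure.restrict_apply hA,
    Measure.restrict_apply (hG hA), smul_eq_mul]
  have : A ∩ G '' ω = G '' (G ⁻¹' A ∩ ω) := by
    rw [inter_comm A, inter_comm (G ⁻¹' A), image_inter_preimage]
  rw [this]
  exact h _ inter_subset_right

end hausd


section bridge
set_option linter.unusedSectionVars false

variable {n : ℕ} {K : Set (EuclideanSpace ℝ (Fin n))}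
  {F : Type*} [NormedAddCommGroup F] [InnerProductSpace ℝ F] [FiniteDimensional ℝ F]
  [MeasurableSpace F] [BorelSpace F]

/-- splitting data of the ambient space as `F ⊕ ℝ e` -/
structure Spl (n : ℕ) (F : Type*) [NormedAddCommGroup F] [InnerProductSpace ℝ F] where
  i : F →ₗᵢ[ℝ] EuclideanSpace ℝ (Fin n)
  P : EuclideanSpace ℝ (Fin n) →ₗ[ℝ] F
  e : EuclideanSpace ℝ (Fin n)
  he : ‖e‖ = 1
  hie : ∀ y, ⟪i y, e⟫ = 0
  hP : ∀ z y, ⟪P z, y⟫ = ⟪z, i y⟫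
  hdec : ∀ z, z = i (P z) + ⟪z, e⟫ • e

namespace Spl

variable (D : Spl n F)

/-- the point of the affine hyperplane -/
def r (y : F) : EuclideanSpace ℝ (Fin n) := D.i y + D.e

/-- restricted support function -/
def v (K : Set (EuclideanSpace ℝ (Fin n))) (y : F) : ℝ := suppFn K (D.r y)

theorem Pi (q : F) : D.P (D.i q) = q := by
  refine ext_inner_right ℝ fun y => ?_
  rw [D.hP, LinearIsometry.inner_map_map]

theorem Pe : D.P D.e = 0 := by
  refine ext_inner_right ℝ fun y => ?_
  rw [D.hP, real_inner_comm, D.hie, inner_zero_left]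

theorem ee : ⟪D.e, D.e⟫ = (1 : ℝ) := by rw [real_inner_self_eq_norm_sq, D.he]; norm_num

theorem r_e (y : F) : ⟪D.r y, D.e⟫ = (1 : ℝ) := by
  rw [r, inner_add_left, D.hie, D.ee, zero_add]

theorem r_inner (y : F) (z : EuclideanSpace ℝ (Fin n)) :
    ⟪D.r y, z⟫ = ⟪D.P z, y⟫ + ⟪z, D.e⟫ := by
  rw [r, inner_add_left, D.hP, real_inner_comm, real_inner_comm D.e]

theorem r_sub (y y' : F) : ‖D.r y - D.r y'‖ = ‖y - y'‖ := by
  rw [r, r, add_sub_add_right_eq_sub, ← map_sub, D.i.norm_map]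

theorem r_ge (y : F) : 1 ≤ ‖D.r y‖ := by
  have h := real_inner_le_norm (D.r y) D.e
  rwa [D.r_e, D.he, mul_one] at h

theorem r_le (y : F) : ‖D.r y‖ ≤ ‖y‖ + 1 := by
  refine (norm_add_le _ _).trans ?_
  rw [D.i.norm_map, D.he]

theorem r_cont : Continuous D.r := by
  unfold r
  have := D.i.continuous
  fun_prop

theorem r_ne (y : F) : D.r y ≠ 0 := by
  intro h
  have := D.r_ge y
  rw [h, norm_zero] at this
  linarith

theorem P_norm (z : EuclideanSpace ℝ (Fin n)) : ‖D.P z‖ ≤ ‖z‖ := by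
  have h := D.hP z (D.P z)
  rw [real_inner_self_eq_norm_sq] at h
  have h2 := real_inner_le_norm z (D.i (D.P z))
  rw [D.i.norm_map] at h2
  by_contra hc
  push Not at hc
  nlinarith [norm_nonneg z]

/-- every vector with positive `e` component is a multiple of some `r y` -/
theorem exists_r (w : EuclideanSpace ℝ (Fin n)) (hw : 0 < ⟪w, D.e⟫) :
    ∃ y, w = ⟪w, D.e⟫ • D.r y := by
  refine ⟨⟪w, D.e⟫⁻¹ • D.P w, ?_⟩
  rw [r, smul_add, map_smul, smul_smul, mul_inv_cancel₀ hw.ne', one_smul]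
  exact D.hdec w

theorem mem_face_r (hK : IsCompact K) (y : F) (z : EuclideanSpace ℝ (Fin n))
    (hz : z ∈ face K (D.r y)) : D.P z ∈ sgr (D.v K) y := by
  intro y'
  have h1 := le_supp hK (D.r y') hz.1
  have h2 := hz.2
  rw [real_inner_comm, D.r_inner] at h2
  rw [D.r_inner] at h1
  rw [v, v, ← h2, inner_sub_right]
  linarith

theorem exists_face (hK : IsCompact K) (hKc : Convex ℝ K) (hne : K.Nonempty) (y : F) (q : F)
    (hq : q ∈ sgr (D.v K) y) : ∃ z ∈ face K (D.r y), D.P z = q := by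
  set z := D.i q + (D.v K y - ⟪q, y⟫) • D.e with hz
  have hPz : D.P z = q := by
    rw [hz, map_add, D.Pi, map_smul, D.Pe, smul_zero, add_zero]
  have hze : ⟪z, D.e⟫ = D.v K y - ⟪q, y⟫ := by
    rw [hz, inner_add_left, D.hie, real_inner_smul_left, D.ee]; ring
  have hzr : ∀ y', ⟪D.r y', z⟫ ≤ D.v K y' := by
    intro y'
    have := hq y'
    rw [inner_sub_right] at this
    rw [D.r_inner, hPz, hze]
    linarith
  obtain ⟨L, hL⟩ := hK.isBounded.exists_norm_le
  have hL0 : 0 ≤ L := (norm_nonneg _).trans (hL _ hne.some_mem)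
  have hex : ∃ t : ℝ, 0 ≤ t ∧ z + t • D.e ∈ K := by
    by_contra hcon
    push Not at hcon
    have hray : (fun t : ℝ => z + t • D.e) '' Ici 0 =
        (fun x => ⟪x - z, D.e⟫) ⁻¹' Ici 0 ∩ {x | x = z + ⟪x - z, D.e⟫ • D.e} := by
      ext x
      constructor
      · rintro ⟨t, ht, rfl⟩
        simp only [mem_inter_iff, mem_preimage, mem_ofPred_eq, add_sub_cancel_left,
          real_inner_smul_left, D.ee, mul_one]
        exact ⟨ht, trivial⟩
      · rintro ⟨h1, h2⟩
        exact ⟨_, h1, h2.symm⟩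
    have hcl : IsClosed ((fun t : ℝ => z + t • D.e) '' Ici 0) := by
      rw [hray]
      refine (isClosed_Ici.preimage (by fun_prop)).inter (isClosed_eq (by fun_prop) (by fun_prop))
    have hcv : Convex ℝ ((fun t : ℝ => z + t • D.e) '' Ici 0) := by
      rintro _ ⟨s, hs, rfl⟩ _ ⟨t, ht, rfl⟩ a b ha hb hab
      refine ⟨a * s + b * t, ?_, ?_⟩
      · simp only [mem_Ici] at *
        positivity
      · have : z = (a + b) • z := by rw [hab, one_smul]
        show z + (a * s + b * t) • D.e = a • (z + s • D.e) + b • (z + t • D.e)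
        nth_rw 1 [this]
        module
    have hdis : Disjoint K ((fun t : ℝ => z + t • D.e) '' Ici 0) := by
      rw [disjoint_left]
      rintro _ hk ⟨t, ht, rfl⟩
      exact hcon t ht hk
    obtain ⟨f, a, b, hfa, hab, hfb⟩ := geometric_hahn_banach_compact_closed hKc hK hcv hcl hdis
    obtain ⟨w, hw⟩ : ∃ w, ∀ x, f x = ⟪w, x⟫ :=
      ⟨(InnerProductSpace.toDual ℝ _).symm f, fun x => by
        rw [InnerProductSpace.toDual_symm_apply]⟩
    have hwe : 0 ≤ ⟪w, D.e⟫ := by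
      by_contra hneg
      push Not at hneg
      have hb0 := hfb _ ⟨0, le_refl (0 : ℝ), rfl⟩
      simp only [zero_smul, add_zero] at hb0
      set t := (f z - b) / -⟪w, D.e⟫ with ht
      have ht0 : 0 ≤ t := div_nonneg (by linarith) (by linarith)
      have := hfb _ ⟨t, ht0, rfl⟩
      simp only [map_add, map_smul, smul_eq_mul] at this
      rw [hw D.e] at this
      have h2 : t * ⟪w, D.e⟫ = -(f z - b) := by
        have hne0 := hneg.ne
        rw [ht]; field_simp
      linarith
    set δ := (b - a) / (‖z‖ + L + 1) with hδ
    have hden : 0 < ‖z‖ + L + 1 := by positivity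
    have hδ0 : 0 < δ := div_pos (by linarith) hden
    have hδe : δ * (‖z‖ + L + 1) = b - a := by rw [hδ]; field_simp
    set w' := w + δ • D.e with hw'
    have hw'e : 0 < ⟪w', D.e⟫ := by
      rw [hw', inner_add_left, real_inner_smul_left, D.ee]; linarith
    obtain ⟨y', hy'⟩ := D.exists_r w' hw'e
    obtain ⟨k, hk, hkv⟩ := supp_att hK hne (D.r y')
    have h1 : ⟪w', z⟫ ≤ ⟪w', k⟫ := by
      rw [hy', real_inner_smul_left, real_inner_smul_left]
      refine mul_le_mul_of_nonneg_left ?_ hw'e.le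
      rw [hkv]; exact hzr y'
    rw [hw', inner_add_left, inner_add_left, real_inner_smul_left, real_inner_smul_left,
      ← hw, ← hw] at h1
    have h2 := hfa k hk
    have h3 := hfb _ ⟨0, le_refl (0 : ℝ), rfl⟩
    simp only [zero_smul, add_zero] at h3
    have h4 := real_inner_le_norm D.e k
    have h5 := abs_real_inner_le_norm D.e z
    rw [D.he, one_mul] at h4 h5
    have h6 := neg_le_of_abs_le h5
    have h7 := hL k hk
    nlinarith
  obtain ⟨t, ht, htK⟩ := hex
  have h1 := le_supp hK (D.r y) htK
  have h2 : ⟪D.r y, z⟫ = D.v K y := by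
    rw [D.r_inner, hPz, hze]; ring
  rw [inner_add_right, h2, real_inner_smul_right, D.r_e] at h1
  have ht0 : t = 0 := by
    rw [v] at h1; linarith
  rw [ht0, zero_smul, add_zero] at htK
  refine ⟨z, ⟨htK, ?_⟩, hPz⟩
  rw [real_inner_comm, h2, v]

theorem Dgr_eq (hK : IsCompact K) (hKc : Convex ℝ K) (hne : K.Nonempty) (ω : Set F) :
    Dgr (D.v K) ω = D.P '' (⋃ y ∈ ω, face K (D.r y)) := by
  ext q
  simp only [Dgr, mem_iUnion, mem_image]
  constructor
  · rintro ⟨y, hy, hq⟩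
    obtain ⟨z, hz, h⟩ := D.exists_face hK hKc hne y q hq
    exact ⟨z, ⟨y, hy, hz⟩, h⟩
  · rintro ⟨z, ⟨y, hy, hz⟩, rfl⟩
    exact ⟨y, hy, D.mem_face_r hK y z hz⟩

/-- gnomonic projection -/
def G (y : F) : EuclideanSpace ℝ (Fin n) := ‖D.r y‖⁻¹ • D.r y

theorem G_norm (y : F) : ‖D.G y‖ = 1 := by
  rw [G, norm_smul, norm_inv, norm_norm, inv_mul_cancel₀]
  exact norm_ne_zero_iff.2 (D.r_ne y)

theorem G_cont : Continuous D.G := by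
  unfold G
  exact (D.r_cont.norm.inv₀ fun y => norm_ne_zero_iff.2 (D.r_ne y)).smul D.r_cont

theorem G_r (y : F) : D.r y = ‖D.r y‖ • D.G y := by
  rw [G, smul_smul, mul_inv_cancel₀ (norm_ne_zero_iff.2 (D.r_ne y)), one_smul]

theorem G_e (y : F) : ‖D.r y‖ * ⟪D.G y, D.e⟫ = 1 := by
  rw [← real_inner_smul_left, ← D.G_r, D.r_e]

theorem G_lip (y y' : F) : dist (D.G y) (D.G y') ≤ 2 * dist y y' := by
  have h1 : D.G y - D.G y' = ‖D.r y‖⁻¹ • ((D.r y - D.r y') + (‖D.r y'‖ - ‖D.r y‖) • D.G y') := by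
    have h := D.G_r y'
    have h0 := norm_ne_zero_iff.2 (D.r_ne y)
    rw [sub_smul, ← h]
    rw [show D.r y - D.r y' + (D.r y' - ‖D.r y‖ • D.G y') = D.r y - ‖D.r y‖ • D.G y' by abel,
      smul_sub, smul_smul, inv_mul_cancel₀ h0, one_smul, G]
  rw [dist_eq_norm, dist_eq_norm, h1, norm_smul, norm_inv, norm_norm]
  have h2 : ‖(D.r y - D.r y') + (‖D.r y'‖ - ‖D.r y‖) • D.G y'‖ ≤ 2 * ‖y - y'‖ := by
    refine (norm_add_le _ _).trans ?_
    rw [norm_smul, D.G_norm, D.r_sub, mul_one, Real.norm_eq_abs]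
    have := abs_norm_sub_norm_le (D.r y') (D.r y)
    rw [D.r_sub, norm_sub_rev] at this
    linarith
  have h3 : ‖D.r y‖⁻¹ ≤ 1 := inv_le_one_of_one_le₀ (D.r_ge y)
  have h4 : 0 ≤ ‖D.r y‖⁻¹ := by positivity
  calc _ ≤ 1 * (2 * ‖y - y'‖) := by gcongr
    _ = _ := one_mul _

theorem G_alip (R : ℝ) (hR : 0 ≤ R) (y y' : F) (hy : ‖y‖ ≤ R) (hy' : ‖y'‖ ≤ R) :
    dist y y' ≤ ((R + 1) + (R + 1) ^ 2) * dist (D.G y) (D.G y') := by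
  rw [dist_eq_norm, dist_eq_norm, ← D.r_sub]
  have h1 : D.r y - D.r y' = ‖D.r y‖ • (D.G y - D.G y') + (‖D.r y‖ - ‖D.r y'‖) • D.G y' := by
    nth_rw 1 [D.G_r y, D.G_r y']
    module
  rw [h1]
  refine (norm_add_le _ _).trans ?_
  rw [norm_smul, norm_smul, D.G_norm, norm_norm, mul_one, Real.norm_eq_abs, add_mul]
  have a1 : ‖D.r y‖ ≤ R + 1 := (D.r_le y).trans (by linarith)
  have a2 : ‖D.r y'‖ ≤ R + 1 := (D.r_le y').trans (by linarith)
  have h2 : ‖D.r y‖ - ‖D.r y'‖ = ‖D.r y‖ * ‖D.r y'‖ * ⟪D.G y' - D.G y, D.e⟫ := by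
    rw [inner_sub_left]
    linear_combination (-‖D.r y‖) * D.G_e y' + ‖D.r y'‖ * D.G_e y
  have h3 : |⟪D.G y' - D.G y, D.e⟫| ≤ ‖D.G y - D.G y'‖ := by
    have := abs_real_inner_le_norm (D.G y' - D.G y) D.e
    rwa [D.he, mul_one, norm_sub_rev] at this
  refine add_le_add (by gcongr) ?_
  rw [h2, abs_mul, abs_of_nonneg (by positivity), pow_two]
  gcongr

theorem face_alip (hK : IsCompact K) (R : ℝ) (hR : 0 ≤ R) (ω : Set F) (hω : ∀ y ∈ ω, ‖y‖ ≤ R)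
    (z z' : EuclideanSpace ℝ (Fin n))
    (hz : z ∈ ⋃ y ∈ ω, face K (D.r y)) (hz' : z' ∈ ⋃ y ∈ ω, face K (D.r y)) :
    dist z z' ≤ (1 + R) * dist (D.P z) (D.P z') := by
  simp only [mem_iUnion] at hz hz'
  obtain ⟨y, hy, hz⟩ := hz
  obtain ⟨y', hy', hz'⟩ := hz'
  rw [dist_eq_norm, dist_eq_norm, ← map_sub]
  have h1 : ⟪D.r y, z'⟫ ≤ ⟪D.r y, z⟫ := by
    rw [real_inner_comm z, hz.2]; exact le_supp hK _ hz'.1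
  have h2 : ⟪D.r y', z⟫ ≤ ⟪D.r y', z'⟫ := by
    rw [real_inner_comm z', hz'.2]; exact le_supp hK _ hz.1
  have h1' : 0 ≤ ⟪D.r y, z - z'⟫ := by rw [inner_sub_right]; linarith
  have h2' : ⟪D.r y', z - z'⟫ ≤ 0 := by rw [inner_sub_right]; linarith
  rw [D.r_inner] at h1' h2'
  have b1 := (abs_real_inner_le_norm (D.P (z - z')) y)
  have b2 := (abs_real_inner_le_norm (D.P (z - z')) y')
  have b3 : ‖D.P (z - z')‖ * ‖y‖ ≤ ‖D.P (z - z')‖ * R := by gcongr; exact hω y hy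
  have b4 : ‖D.P (z - z')‖ * ‖y'‖ ≤ ‖D.P (z - z')‖ * R := by gcongr; exact hω y' hy'
  rw [abs_le] at b1 b2
  have b5 : |⟪z - z', D.e⟫| ≤ ‖D.P (z - z')‖ * R := by
    rw [abs_le]; constructor <;> linarith
  have h3 := norm_add_le (D.i (D.P (z - z'))) (⟪z - z', D.e⟫ • D.e)
  rw [← D.hdec, D.i.norm_map, norm_smul, D.he, mul_one, Real.norm_eq_abs] at h3
  linarith

end Spl

end bridge


section bridge2
set_option linter.unusedSectionVars false

variable {n : ℕ} {K : Set (EuclideanSpace ℝ (Fin n))}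
  {F : Type*} [NormedAddCommGroup F] [InnerProductSpace ℝ F] [FiniteDimensional ℝ F]
  [MeasurableSpace F] [BorelSpace F]

namespace Spl

variable (D : Spl n F)

theorem supp_G (hK : IsCompact K) (hne : K.Nonempty) (y : F) :
    suppFn K (D.G y) = ‖D.r y‖⁻¹ * D.v K y := by
  rw [G, supp_smul hK hne _ _ (by positivity), v]

theorem face_G (hK : IsCompact K) (hne : K.Nonempty) (y : F) :
    face K (D.G y) = face K (D.r y) := by
  rw [G, face_smul hK hne]
  have := D.r_ge y
  positivity

theorem null_of_bdd (hK : IsCompact K) (hne : K.Nonempty) (hn : 1 ≤ n)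
    (h : μH[(n : ℝ) - 1] {u ∈ unitSphere n | suppFn K u = 0} = 0)
    (hb : Bornology.IsBounded {y | D.v K y = 0}) :
    μH[(n : ℝ) - 1] {y | D.v K y = 0} = 0 := by
  have hd : (0 : ℝ) ≤ (n : ℝ) - 1 := by
    have : (1 : ℝ) ≤ n := by exact_mod_cast hn
    linarith
  obtain ⟨R, hR⟩ := hb.exists_norm_le
  have h1 := haus_alip ((n : ℝ) - 1) hd D.G {y | D.v K y = 0}
    ((|R| + 1) + (|R| + 1) ^ 2) (by positivity) (fun x hx y hy =>
      D.G_alip |R| (abs_nonneg _) x y ((hR x hx).trans (le_abs_self _))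
        ((hR y hy).trans (le_abs_self _)))
  have h2 : μH[(n : ℝ) - 1] (D.G '' {y | D.v K y = 0}) = 0 := by
    refine measure_mono_null ?_ h
    rintro _ ⟨y, hy, rfl⟩
    refine ⟨?_, ?_⟩
    · rw [unitSphere, mem_sphere_zero_iff_norm, D.G_norm]
    · rw [D.supp_G hK hne, show D.v K y = 0 from hy, mul_zero]
  rw [h2, mul_zero] at h1
  exact le_antisymm h1 zero_le

theorem dens (hK : IsCompact K) (hKc : Convex ℝ K) (hne : K.Nonempty) (hn : 1 ≤ n)
    {p : ℝ} (hp : p < 1) {τ1 τ2 : ℝ} (hτ1 : 0 < τ1) (hτ12 : τ1 < τ2)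
    {f : EuclideanSpace ℝ (Fin n) → ℝ}
    (hf : ∀ u ∈ unitSphere n, τ1 < f u ∧ f u < τ2) (hsol : IsLpSolution p f K) :
    DensHyp (μH[(n : ℝ) - 1] : Measure F) (D.v K) p := by
  intro R0
  set d : ℝ := (n : ℝ) - 1 with hdd
  have hn1 : (1 : ℝ) ≤ n := by exact_mod_cast hn
  have hτ2 : 0 < τ2 := hτ1.trans hτ12
  have hd : (0 : ℝ) ≤ d := by linarith
  set R := |R0| with hRdef
  have hR : 0 ≤ R := abs_nonneg _
  set A1 : ℝ≥0∞ := ENNReal.ofReal 2 ^ d with hA1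
  set A2 : ℝ≥0∞ := ENNReal.ofReal ((R + 1) + (R + 1) ^ 2) ^ d with hA2
  set A3 : ℝ≥0∞ := ENNReal.ofReal (1 + R) ^ d with hA3
  have tA1 : A1 ≠ ⊤ := ENNReal.rpow_ne_top_of_nonneg hd ENNReal.ofReal_ne_top
  have tA2 : A2 ≠ ⊤ := ENNReal.rpow_ne_top_of_nonneg hd ENNReal.ofReal_ne_top
  have tA3 : A3 ≠ ⊤ := ENNReal.rpow_ne_top_of_nonneg hd ENNReal.ofReal_ne_top
  set B : ℝ := (R + 1) ^ (1 - p) with hB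
  have hB0 : 0 < B := by positivity
  set T1 := ENNReal.ofReal (n * τ1) with hT1
  set T2 := ENNReal.ofReal (n * τ2) with hT2
  have hT10 : T1 ≠ 0 := by
    simp only [hT1, ne_eq, ENNReal.ofReal_eq_zero, not_le]; positivity
  have hT1t : T1 ≠ ⊤ := ENNReal.ofReal_ne_top
  set Q1 := T2 * (A1 * ENNReal.ofReal B) with hQ1
  set Q2 := A2 * (T1⁻¹ * A3) with hQ2
  have tQ1 : Q1 ≠ ⊤ := ENNReal.mul_ne_top ENNReal.ofReal_ne_top
    (ENNReal.mul_ne_top tA1 ENNReal.ofReal_ne_top)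
  have tQ2 : Q2 ≠ ⊤ := ENNReal.mul_ne_top tA2
    (ENNReal.mul_ne_top (ENNReal.inv_ne_top.2 hT10) tA3)
  refine ⟨Q1 + Q2, ENNReal.add_ne_top.2 ⟨tQ1, tQ2⟩, fun ω hω hωR hωv => ?_⟩
  have hωR' : ∀ y ∈ ω, ‖y‖ ≤ R := fun y hy =>
    ((mem_ball_zero_iff.1 (hωR hy)).le).trans (le_abs_self _)
  have hinj : InjOn D.G ω := by
    intro x hx y hy hxy
    have := D.G_alip R hR x y (hωR' x hx) (hωR' y hy)
    rw [hxy, dist_self, mul_zero] at this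
    exact dist_le_zero.1 this
  set S := D.G '' ω with hS
  have hSm : MeasurableSet S := hω.image_of_continuousOn_injOn D.G_cont.continuousOn hinj
  have hSp : S ⊆ {u ∈ unitSphere n | 0 < suppFn K u} := by
    rintro _ ⟨y, hy, rfl⟩
    refine ⟨?_, ?_⟩
    · rw [unitSphere, mem_sphere_zero_iff_norm, D.G_norm]
    · rw [D.supp_G hK hne]
      have := D.r_ge y
      have := hωv y hy
      positivity
  have hsurf := hsol.2 S hSm hSp
  set φ : EuclideanSpace ℝ (Fin n) → ℝ≥0∞ := fun u => ENNReal.ofReal (suppFn K u ^ (p - 1)) with hφ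
  have hφm : Measurable φ := by
    have := (supp_cont hK hne).measurable
    rw [hφ]
    exact (this.pow_const _).ennreal_ofReal
  have up1 : surfMeas K S ≤ T2 * ∫⁻ u in S, φ u ∂μH[d] := by
    rw [hsurf, ← lintegral_const_mul _ hφm]
    refine setLIntegral_mono' hSm fun u hu => ?_
    have h1 := hSp hu
    have h2 := hf u h1.1
    have h3 : 0 ≤ suppFn K u ^ (p - 1) := Real.rpow_nonneg h1.2.le _
    rw [hT2, hφ, ← ENNReal.ofReal_mul (by positivity)]
    refine ENNReal.ofReal_le_ofReal ?_
    gcongr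
    exact h2.2.le
  have lo1 : T1 * ∫⁻ u in S, φ u ∂μH[d] ≤ surfMeas K S := by
    rw [hsurf, ← lintegral_const_mul _ hφm]
    refine setLIntegral_mono' hSm fun u hu => ?_
    have h1 := hSp hu
    have h2 := hf u h1.1
    have h3 : 0 ≤ suppFn K u ^ (p - 1) := Real.rpow_nonneg h1.2.le _
    rw [hT1, hφ, ← ENNReal.ofReal_mul (by positivity)]
    refine ENNReal.ofReal_le_ofReal ?_
    gcongr
    exact h2.1.le
  have up2 : ∫⁻ u in S, φ u ∂μH[d] ≤ A1 * ∫⁻ y in ω, φ (D.G y) ∂μH[d] :=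
    lint_img_le d D.G D.G_cont.measurable ω hSm A1 (fun s _ =>
      haus_lip d hd D.G s 2 (by norm_num) fun x _ y _ => D.G_lip x y) φ hφm hω
  have lo2 : ∫⁻ y in ω, φ (D.G y) ∂μH[d] ≤ A2 * ∫⁻ u in S, φ u ∂μH[d] :=
    lint_img_ge d D.G D.G_cont.measurable ω A2 (fun s hs =>
      haus_alip d hd D.G s _ (by positivity) fun x hx y hy =>
        D.G_alip R hR x y (hωR' x (hs hx)) (hωR' y (hs hy))) φ hφm hω
  have hvc : Continuous (D.v K) := (supp_cont hK hne).comp D.r_cont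
  have hgm : Measurable fun y => ENNReal.ofReal (D.v K y ^ (p - 1)) :=
    (hvc.measurable.pow_const _).ennreal_ofReal
  have up3 : ∫⁻ y in ω, φ (D.G y) ∂μH[d] ≤
      ENNReal.ofReal B * ∫⁻ y in ω, ENNReal.ofReal (D.v K y ^ (p - 1)) ∂μH[d] := by
    rw [← lintegral_const_mul _ hgm]
    refine setLIntegral_mono' hω fun y hy => ?_
    have hv := hωv y hy
    have hr := D.r_ge y
    have hr2 : ‖D.r y‖ ≤ R + 1 := (D.r_le y).trans (by linarith [hωR' y hy])
    rw [hφ, ← ENNReal.ofReal_mul hB0.le]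
    refine ENNReal.ofReal_le_ofReal ?_
    show suppFn K (D.G y) ^ (p - 1) ≤ _
    rw [D.supp_G hK hne, Real.mul_rpow (by positivity) hv.le]
    gcongr
    rw [Real.inv_rpow (by positivity), ← Real.rpow_neg (by positivity), neg_sub]
    exact Real.rpow_le_rpow (by positivity) hr2 (by linarith)
  have lo3 : ∫⁻ y in ω, ENNReal.ofReal (D.v K y ^ (p - 1)) ∂μH[d] ≤
      ∫⁻ y in ω, φ (D.G y) ∂μH[d] := by
    refine setLIntegral_mono' hω fun y hy => ?_
    have hv := hωv y hy
    have hr := D.r_ge y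
    refine ENNReal.ofReal_le_ofReal ?_
    rw [D.supp_G hK hne]
    refine Real.rpow_le_rpow_of_nonpos (by positivity) ?_ (by linarith)
    have : ‖D.r y‖⁻¹ ≤ 1 := inv_le_one_of_one_le₀ hr
    nlinarith
  have hTT : (⋃ u ∈ S, face K u) = ⋃ y ∈ ω, face K (D.r y) := by
    rw [hS, biUnion_image]
    simp only [D.face_G hK hne]
  have hDg := D.Dgr_eq hK hKc hne ω
  have up0 : μH[d] (Dgr (D.v K) ω) ≤ surfMeas K S := by
    rw [surfMeas, hTT, hDg]
    have := haus_lip d hd D.P (⋃ y ∈ ω, face K (D.r y)) 1 (by norm_num) (fun x _ y _ => by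
      rw [dist_eq_norm, dist_eq_norm, ← map_sub, one_mul]; exact D.P_norm _)
    rwa [ENNReal.ofReal_one, ENNReal.one_rpow, one_mul] at this
  have lo0 : surfMeas K S ≤ A3 * μH[d] (Dgr (D.v K) ω) := by
    rw [surfMeas, hTT, hDg]
    exact haus_alip d hd D.P _ (1 + R) (by positivity) fun z hz z' hz' =>
      D.face_alip hK R hR ω hωR' z z' hz hz'
  constructor
  · calc _ ≤ T2 * (A1 * (ENNReal.ofReal B *
          ∫⁻ y in ω, ENNReal.ofReal (D.v K y ^ (p - 1)) ∂μH[d])) := by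
            refine up0.trans (up1.trans ?_)
            gcongr
            refine up2.trans ?_
            gcongr
      _ = Q1 * ∫⁻ y in ω, ENNReal.ofReal (D.v K y ^ (p - 1)) ∂μH[d] := by rw [hQ1]; ring
      _ ≤ _ := by gcongr; exact le_self_add
  · calc _ ≤ A2 * (T1⁻¹ * (A3 * μH[d] (Dgr (D.v K) ω))) := by
            refine lo3.trans (lo2.trans ?_)
            gcongr
            rw [← ENNReal.div_eq_inv_mul, ENNReal.le_div_iff_mul_le (Or.inl hT10) (Or.inl hT1t),
              mul_comm]
            exact lo1.trans lo0
      _ = Q2 * μH[d] (Dgr (D.v K) ω) := by rw [hQ2]; ring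
      _ ≤ _ := by gcongr; exact le_add_self

end Spl

end bridge2


section geom
set_option linter.unusedSectionVars false

variable {n : ℕ} {K : Set (EuclideanSpace ℝ (Fin n))}

theorem exists_dir (hint : (interior K).Nonempty) (x : EuclideanSpace ℝ (Fin n))
    (hx : x ∈ frontier K) :
    ∃ e : EuclideanSpace ℝ (Fin n), ‖e‖ = 1 ∧ ∃ M : ℝ, 0 ≤ M ∧
      ∀ u ∈ normalCone K x, ‖u‖ ≤ M * ⟪u, e⟫ := by
  obtain ⟨c, hc⟩ := hint
  have hxc : x - c ≠ 0 := by
    rw [sub_ne_zero]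
    rintro rfl
    exact hx.2 hc
  have hpos : 0 < ‖x - c‖ := norm_pos_iff.2 hxc
  obtain ⟨ρ, hρ, hball⟩ := Metric.isOpen_iff.1 isOpen_interior c hc
  refine ⟨‖x - c‖⁻¹ • (x - c), ?_, 2 * ‖x - c‖ / ρ, by positivity, fun u hu => ?_⟩
  · rw [norm_smul, norm_inv, norm_norm, inv_mul_cancel₀ hpos.ne']
  rcases eq_or_ne u 0 with rfl | hu0
  · simp
  have hup : 0 < ‖u‖ := norm_pos_iff.2 hu0
  have hk : c + (ρ / 2 * ‖u‖⁻¹) • u ∈ K := by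
    refine interior_subset (hball ?_)
    rw [mem_ball_iff_norm, add_sub_cancel_left, norm_smul, norm_mul, norm_inv, norm_norm,
      mul_assoc, inv_mul_cancel₀ hup.ne', Real.norm_of_nonneg (by positivity)]
    linarith
  have h1 := hu _ hk
  rw [inner_add_right, real_inner_smul_right, real_inner_self_eq_norm_sq] at h1
  have h2 : ρ / 2 * ‖u‖⁻¹ * ‖u‖ ^ 2 = ρ / 2 * ‖u‖ := by field_simp
  rw [h2] at h1
  rw [real_inner_smul_right, inner_sub_right]
  have h3 : 2 * ‖x - c‖ / ρ * (‖x - c‖⁻¹ * (⟪u, x⟫ - ⟪u, c⟫)) = 2 / ρ * (⟪u, x⟫ - ⟪u, c⟫) := by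
    field_simp
  rw [h3, div_mul_eq_mul_div, le_div_iff₀ hρ]
  linarith

theorem exists_normal (hKc : Convex ℝ K) (hint : (interior K).Nonempty)
    (x : EuclideanSpace ℝ (Fin n)) (hx : x ∈ frontier K) : ∃ u ∈ normalCone K x, u ≠ 0 := by
  obtain ⟨f, hf⟩ := geometric_hahn_banach_open_point hKc.interior isOpen_interior hx.2
  obtain ⟨w, hw⟩ : ∃ w, ∀ x, f x = ⟪w, x⟫ :=
    ⟨(InnerProductSpace.toDual ℝ _).symm f, fun x => by
      rw [InnerProductSpace.toDual_symm_apply]⟩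
  refine ⟨w, fun y hy => ?_, ?_⟩
  · have h1 : y ∈ closure (interior K) := by
      rw [hKc.closure_interior_eq_closure_of_nonempty_interior hint]
      exact subset_closure hy
    have h2 : closure (interior K) ⊆ {z | f z ≤ f x} :=
      closure_minimal (fun z hz => (hf z hz).le) (isClosed_le f.continuous continuous_const)
    have := h2 h1
    rw [← hw, ← hw]; exact this
  · rintro rfl
    obtain ⟨c, hc⟩ := hint
    have := hf c hc
    rw [hw, hw, inner_zero_left, inner_zero_left] at this
    exact lt_irrefl _ this

theorem finrank_span_ne_zero (u : EuclideanSpace ℝ (Fin n)) (N : Set (EuclideanSpace ℝ (Fin n)))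
    (hu : u ∈ N) (hu0 : u ≠ 0) : Module.finrank ℝ (Submodule.span ℝ N) ≠ 0 := by
  intro h
  rw [Submodule.finrank_eq_zero] at h
  have : u ∈ Submodule.span ℝ N := Submodule.subset_span hu
  rw [h, Submodule.mem_bot] at this
  exact hu0 this

/-- the standard splitting -/
def mkSpl (e : EuclideanSpace ℝ (Fin n)) (he : ‖e‖ = 1) :
    Spl n (Submodule.span ℝ {e})ᗮ where
  i := (Submodule.span ℝ {e})ᗮ.subtypeₗᵢ
  P := ((Submodule.span ℝ {e})ᗮ.orthogonalProjectionOnto).toLinearMap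
  e := e
  he := he
  hie := fun y => by
    rw [real_inner_comm]
    exact Submodule.mem_orthogonal_singleton_iff_inner_right.1 y.2
  hP := fun z y => by
    simp
  hdec := fun z => by
    have h1 := Submodule.starProjection_add_starProjection_orthogonal (K := Submodule.span ℝ {e}) z
    have h2 := Submodule.starProjection_unit_singleton ℝ he z
    rw [h2] at h1
    nth_rw 1 [← h1]
    rw [add_comm, real_inner_comm]
    rfl

theorem finrank_orth (e : EuclideanSpace ℝ (Fin n)) (he : e ≠ 0) :
    Module.finrank ℝ (Submodule.span ℝ {e})ᗮ = n - 1 := by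
  have h1 := (Submodule.span ℝ {e}).finrank_add_finrank_orthogonal
  rw [finrank_span_singleton he, finrank_euclideanSpace_fin] at h1
  omega

variable {F : Type*} [NormedAddCommGroup F] [InnerProductSpace ℝ F] [FiniteDimensional ℝ F]
  [MeasurableSpace F] [BorelSpace F]

theorem haar_F (hn : 1 ≤ n) (hF : Module.finrank ℝ F = n - 1) :
    (μH[(n : ℝ) - 1] : Measure F).IsAddHaarMeasure := by
  have h : (n : ℝ) - 1 = (Module.finrank ℝ F : ℝ) := by
    rw [hF, Nat.cast_sub hn]; simp
  rw [h]
  infer_instance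

namespace Spl

variable (D : Spl n F)

theorem contact_iff (hK : IsCompact K) (x : EuclideanSpace ℝ (Fin n)) (hx : x ∈ K) (y : F) :
    D.v K y = ⟪D.P x, y⟫ + ⟪x, D.e⟫ ↔ D.r y ∈ normalCone K x := by
  rw [mem_normalCone_iff hK _ _ hx, D.r_inner, v]

theorem zero_iff (hK : IsCompact K) (h0 : 0 ∈ K) (y : F) :
    D.v K y = 0 ↔ D.r y ∈ normalCone K 0 := by
  rw [← D.contact_iff hK 0 h0]; simp

theorem v_cont (hK : IsCompact K) (hne : K.Nonempty) : Continuous (D.v K) :=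
  (supp_cont hK hne).comp D.r_cont

theorem v_nonneg (hK : IsCompact K) (h0 : 0 ∈ K) (y : F) : 0 ≤ D.v K y := by
  have := le_supp hK (D.r y) h0
  rwa [inner_zero_right] at this

theorem v_convex (hK : IsCompact K) (hne : K.Nonempty) : ConvexOn ℝ univ (D.v K) := by
  refine ⟨convex_univ, fun x _ y _ a b ha hb hab => ?_⟩
  have h := (supp_convex hK hne).2 (mem_univ (D.r x)) (mem_univ (D.r y)) ha hb hab
  have h2 : D.r (a • x + b • y) = a • D.r x + b • D.r y := by
    have : D.e = (a + b) • D.e := by rw [hab, one_smul]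
    simp only [r, map_add, map_smul]
    nth_rw 1 [this]
    module
  rw [v, h2]
  exact h

theorem v_ge (hK : IsCompact K) (x : EuclideanSpace ℝ (Fin n)) (hx : x ∈ K) (y : F) :
    ⟪D.P x, y⟫ + ⟪x, D.e⟫ ≤ D.v K y := by
  rw [← D.r_inner]
  exact le_supp hK _ hx

theorem contact_compact (hK : IsCompact K) (x : EuclideanSpace ℝ (Fin n)) (hx : x ∈ K) (M : ℝ)
    (hM : ∀ u ∈ normalCone K x, ‖u‖ ≤ M * ⟪u, D.e⟫) :
    IsCompact {y | D.v K y = ⟪D.P x, y⟫ + ⟪x, D.e⟫} := by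
  have hc := D.v_cont hK ⟨x, hx⟩
  refine Metric.isCompact_of_isClosed_isBounded (isClosed_eq hc (by fun_prop)) ?_
  refine (Metric.isBounded_closedBall (x := (0 : F)) (r := M + 1)).subset fun y hy => ?_
  have h1 := hM _ ((D.contact_iff hK x hx y).1 hy)
  rw [D.r_e, mul_one] at h1
  rw [mem_closedBall_zero_iff, ← D.i.norm_map]
  have h2 : D.i y = D.r y - D.e := by rw [r]; abel
  rw [h2]
  have := norm_sub_le (D.r y) D.e
  rw [D.he] at this
  linarith

theorem cone_smul (x u : EuclideanSpace ℝ (Fin n)) (t : ℝ) (ht : 0 ≤ t) (hu : u ∈ normalCone K x) :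
    t • u ∈ normalCone K x := by
  intro y hy
  rw [real_inner_smul_left, real_inner_smul_left]
  exact mul_le_mul_of_nonneg_left (hu y hy) ht

theorem cone_r (x : EuclideanSpace ℝ (Fin n)) (M : ℝ)
    (hM : ∀ u ∈ normalCone K x, ‖u‖ ≤ M * ⟪u, D.e⟫) (hM0 : 0 ≤ M) (u : EuclideanSpace ℝ (Fin n))
    (hu : u ∈ normalCone K x) (hu0 : u ≠ 0) :
    ∃ y, D.r y ∈ normalCone K x ∧ ∃ t : ℝ, 0 < t ∧ u = t • D.r y := by
  have h1 := hM u hu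
  have h2 : 0 < ‖u‖ := norm_pos_iff.2 hu0
  have h3 : 0 < ⟪u, D.e⟫ := by
    by_contra h
    push Not at h
    nlinarith [mul_nonneg hM0 (neg_nonneg.2 h)]
  obtain ⟨y, hy⟩ := D.exists_r u h3
  refine ⟨y, ?_, _, h3, hy⟩
  have : D.r y = ⟪u, D.e⟫⁻¹ • u := by
    nth_rw 2 [hy]
    rw [smul_smul, inv_mul_cancel₀ h3.ne', one_smul]
  rw [this]
  exact cone_smul x u _ (by positivity) hu

theorem two_pts (hKc : Convex ℝ K) (hint : (interior K).Nonempty) (x : EuclideanSpace ℝ (Fin n))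
    (hx : x ∈ frontier K) (M : ℝ)
    (hM : ∀ u ∈ normalCone K x, ‖u‖ ≤ M * ⟪u, D.e⟫) (hM0 : 0 ≤ M)
    (hns : Module.finrank ℝ (Submodule.span ℝ (normalCone K x)) ≠ 1) :
    ∃ y1 y2, y1 ≠ y2 ∧ D.r y1 ∈ normalCone K x ∧ D.r y2 ∈ normalCone K x := by
  obtain ⟨u, hu, hu0⟩ := exists_normal hKc hint x hx
  obtain ⟨y1, hy1, -⟩ := D.cone_r x M hM hM0 u hu hu0
  by_contra hcon
  push Not at hcon
  apply hns
  have : Submodule.span ℝ (normalCone K x) = Submodule.span ℝ {D.r y1} := by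
    apply le_antisymm
    · rw [Submodule.span_le]
      intro w hw
      rcases eq_or_ne w 0 with rfl | hw0
      · exact Submodule.zero_mem _
      obtain ⟨y, hy, t, -, rfl⟩ := D.cone_r x M hM hM0 w hw hw0
      have : y = y1 := by
        by_contra hne
        exact hcon y1 y (Ne.symm hne) hy1 hy
      rw [this]
      exact Submodule.smul_mem _ _ (Submodule.mem_span_singleton_self _)
    · rw [Submodule.span_le, singleton_subset_iff]
      exact Submodule.subset_span hy1
  rw [this, finrank_span_singleton (D.r_ne y1)]

end Spl

end geom


section final
set_option linter.unusedSectionVars false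

variable {n : ℕ} {K : Set (EuclideanSpace ℝ (Fin n))}
variable {F : Type*} [NormedAddCommGroup F] [InnerProductSpace ℝ F] [FiniteDimensional ℝ F]
  [MeasurableSpace F] [BorelSpace F]

namespace Spl

variable (D : Spl n F)

theorem part1 (hn : 1 ≤ n) (hF : Module.finrank ℝ F = n - 1) (hK : IsConvexBody0 K)
    {p : ℝ} (hp : p < 1) (hH : DensHyp (μH[(n : ℝ) - 1] : Measure F) (D.v K) p)
    (x : EuclideanSpace ℝ (Fin n)) (hx : x ∈ frontier K) (M : ℝ)
    (hM : ∀ u ∈ normalCone K x, ‖u‖ ≤ M * ⟪u, D.e⟫) (hM0 : 0 ≤ M)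
    (hns : Module.finrank ℝ (Submodule.span ℝ (normalCone K x)) ≠ 1) :
    normalCone K x ⊆ normalCone K 0 := by
  obtain ⟨hKk, hKc, hint, h0⟩ := hK
  have hxK : x ∈ K := hKk.isClosed.frontier_subset hx
  have := haar_F (F := F) hn hF
  obtain ⟨y1, y2, hne, h1, h2⟩ := D.two_pts hKc hint x hx M hM hM0 hns
  have key := P1_abs (μH[(n : ℝ) - 1] : Measure F) (D.v K) (D.v_convex hKk ⟨0, h0⟩)
    (D.v_cont hKk ⟨0, h0⟩) p hp hH (D.v_nonneg hKk h0) (D.P x) ⟪x, D.e⟫ (D.v_ge hKk x hxK)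
    (D.contact_compact hKk x hxK M hM) y1 y2 hne ((D.contact_iff hKk x hxK y1).2 h1)
    ((D.contact_iff hKk x hxK y2).2 h2)
  intro u hu
  rcases eq_or_ne u 0 with rfl | hu0
  · intro y _; simp
  obtain ⟨y, hy, t, ht, rfl⟩ := D.cone_r x M hM hM0 u hu hu0
  exact cone_smul 0 _ t ht.le
    ((D.zero_iff hKk h0 y).1 (key y ((D.contact_iff hKk x hxK y).2 hy)))

theorem face_null (hn : 1 ≤ n) (hF : Module.finrank ℝ F = n - 1) (hK : IsConvexBody0 K) (y : F)
    (hfin : Module.finrank ℝ (affineSpan ℝ (face K (D.r y))).direction ≠ n - 1) :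
    (μH[(n : ℝ) - 1] : Measure F) (sgr (D.v K) y) = 0 := by
  obtain ⟨hKk, hKc, hint, h0⟩ := hK
  have := haar_F (F := F) hn hF
  rcases (sgr (D.v K) y).eq_empty_or_nonempty with he | ⟨q0, hq0⟩
  · rw [he]; simp
  obtain ⟨z0, hz0, -⟩ := D.exists_face hKk hKc ⟨0, h0⟩ y q0 hq0
  set W := (affineSpan ℝ (face K (D.r y))).direction with hW
  have hle : W ≤ (Submodule.span ℝ {D.r y})ᗮ := by
    rw [hW, direction_affineSpan, vectorSpan_def, Submodule.span_le]
    rintro _ ⟨a, ha, b, hb, rfl⟩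
    rw [SetLike.mem_coe, Submodule.mem_orthogonal_singleton_iff_inner_left]
    show ⟪a - b, D.r y⟫ = 0
    rw [inner_sub_left, ha.2, hb.2, sub_self]
  have hlt : Module.finrank ℝ W < n - 1 := by
    have := Submodule.finrank_mono hle
    rw [finrank_orth _ (D.r_ne y)] at this
    omega
  set A := AffineSubspace.mk' (D.P z0) (W.map D.P) with hA
  have hAtop : A ≠ ⊤ := by
    intro h
    have h1 : A.direction = ⊤ := by rw [h, AffineSubspace.direction_top]
    rw [hA, AffineSubspace.direction_mk'] at h1
    have h2 := Submodule.finrank_map_le D.P W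
    rw [h1, finrank_top, hF] at h2
    omega
  refine measure_mono_null ?_ (Measure.addHaar_affineSubspace _ A hAtop)
  intro q hq
  obtain ⟨z, hz, rfl⟩ := D.exists_face hKk hKc ⟨0, h0⟩ y q hq
  rw [SetLike.mem_coe, hA, AffineSubspace.mem_mk', vsub_eq_sub, ← map_sub]
  refine Submodule.mem_map_of_mem ?_
  rw [hW]
  exact AffineSubspace.vsub_mem_direction (subset_affineSpan ℝ _ hz) (subset_affineSpan ℝ _ hz0)

theorem part23 (hn : 1 ≤ n) (hF : Module.finrank ℝ F = n - 1) (hn5 : n ≤ 5)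
    (hK : IsConvexBody0 K)
    {p : ℝ} (hp : p < 1) (hH : DensHyp (μH[(n : ℝ) - 1] : Measure F) (D.v K) p)
    (hz : μH[(n : ℝ) - 1] {u ∈ unitSphere n | suppFn K u = 0} = 0)
    (hx : 0 ∈ frontier K) (M : ℝ)
    (hM : ∀ u ∈ normalCone K 0, ‖u‖ ≤ M * ⟪u, D.e⟫) (hM0 : 0 ≤ M)
    (hns : Module.finrank ℝ (Submodule.span ℝ (normalCone K 0)) ≠ 1) :
    Module.finrank ℝ (Submodule.span ℝ (normalCone K 0)) ≤ 2 ∧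
      ∃ u ∈ normalCone K 0, u ≠ 0 ∧
        Module.finrank ℝ (affineSpan ℝ (face K u)).direction = n - 1 := by
  have hK' := hK
  obtain ⟨hKk, hKc, hint, h0⟩ := hK
  have := haar_F (F := F) hn hF
  obtain ⟨y0, y1, hne, h1, h2⟩ := D.two_pts hKc hint 0 hx M hM hM0 hns
  have hC : IsCompact {y | D.v K y = 0} := by
    have := D.contact_compact hKk 0 h0 M hM
    simpa using this
  have hnull := D.null_of_bdd hKk ⟨0, h0⟩ hn hz hC.isBounded
  have hvc := D.v_cont hKk ⟨0, h0⟩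
  have hv0 := D.v_nonneg hKk h0
  have hzi := D.zero_iff hKk h0
  have hline : ∀ y, D.v K y = 0 → ∃ s : ℝ, y = y0 + s • (y1 - y0) := by
    intro y2 hy2
    rw [hzi] at hy2
    by_contra hcon
    push Not at hcon
    have hli : LinearIndependent ℝ ![(1 / 6 : ℝ) • (y1 - y0), (1 / 6 : ℝ) • (y2 - y0)] := by
      rw [LinearIndependent.pair_iff' (smul_ne_zero (by norm_num) (sub_ne_zero.2 hne.symm))]
      intro s hs
      apply hcon s
      rw [smul_comm] at hs
      have := smul_right_injective F (show (1 / 6 : ℝ) ≠ 0 by norm_num) hs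
      rw [this]; abel
    obtain ⟨L, hL⟩ := hKk.isBounded.exists_norm_le
    have hL0 : 0 ≤ L := (norm_nonneg _).trans (hL _ h0)
    refine P3_abs (μH[(n : ℝ) - 1] : Measure F) (D.v K) hvc p hp hH hv0 (L + 1) (by positivity)
      (fun y y' => ?_) (by omega) hnull (y0 + (1 / 3 : ℝ) • (y1 - y0) + (1 / 3 : ℝ) • (y2 - y0))
      _ hli (fun t ht => ?_)
    · have := supp_lip hKk ⟨0, h0⟩ (L + 1) (fun z hz => (hL z hz).trans (by linarith)) (D.r y)
        (D.r y')
      rwa [D.r_sub] at this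
    · rw [hzi]
      have ht0 := abs_le.1 (ht 0)
      have ht1 := abs_le.1 (ht 1)
      simp only [Fin.sum_univ_two, Matrix.cons_val_zero, Matrix.cons_val_one]
      have hr : D.r (y0 + (1 / 3 : ℝ) • (y1 - y0) + (1 / 3 : ℝ) • (y2 - y0) +
          (t 0 • (1 / 6 : ℝ) • (y1 - y0) + t 1 • (1 / 6 : ℝ) • (y2 - y0))) =
          (1 / 3 - t 0 / 6 - t 1 / 6) • D.r y0 + (1 / 3 + t 0 / 6) • D.r y1 +
            (1 / 3 + t 1 / 6) • D.r y2 := by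
        simp only [r, map_add, map_smul, map_sub]
        module
      rw [hr]
      intro k hk
      have k1 := h1 k hk
      have k2 := h2 k hk
      have k3 := hy2 k hk
      rw [inner_zero_right] at k1 k2 k3 ⊢
      simp only [inner_add_left, real_inner_smul_left]
      have m1 := mul_nonneg (show 0 ≤ 1 / 3 - t 0 / 6 - t 1 / 6 by linarith) (neg_nonneg.2 k1)
      have m2 := mul_nonneg (show 0 ≤ 1 / 3 + t 0 / 6 by linarith) (neg_nonneg.2 k2)
      have m3 := mul_nonneg (show 0 ≤ 1 / 3 + t 1 / 6 by linarith) (neg_nonneg.2 k3)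
      linarith
  refine ⟨?_, ?_⟩
  · have hsub : Submodule.span ℝ (normalCone K 0) ≤
        Submodule.span ℝ (({D.r y0, D.r y1} : Finset (EuclideanSpace ℝ (Fin n))) :
          Set (EuclideanSpace ℝ (Fin n))) := by
      rw [Submodule.span_le]
      intro w hw
      rcases eq_or_ne w 0 with rfl | hw0
      · exact Submodule.zero_mem _
      obtain ⟨y, hy, t, -, rfl⟩ := D.cone_r 0 M hM hM0 w hw hw0
      obtain ⟨s, rfl⟩ := hline y ((hzi y).2 hy)
      refine Submodule.smul_mem _ _ ?_
      have : D.r (y0 + s • (y1 - y0)) = (1 - s) • D.r y0 + s • D.r y1 := by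
        simp only [r, map_add, map_smul, map_sub]
        module
      rw [this]
      refine Submodule.add_mem _ (Submodule.smul_mem _ _ (Submodule.subset_span (by simp)))
        (Submodule.smul_mem _ _ (Submodule.subset_span (by simp)))
    refine (Submodule.finrank_mono hsub).trans ((finrank_span_finset_le_card _).trans ?_)
    exact Finset.card_le_two
  · by_contra hcon
    push Not at hcon
    have hCne : {y | D.v K y = 0}.Nonempty := ⟨y0, (hzi y0).2 h1⟩
    have hg : Continuous fun y : F => ⟪y1 - y0, y⟫ := by fun_prop
    obtain ⟨a, ha, hamin⟩ := hC.exists_isMinOn hCne hg.continuousOn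
    obtain ⟨b, hb, hbmax⟩ := hC.exists_isMaxOn hCne hg.continuousOn
    have hT : 0 < ⟪y1 - y0, y1 - y0⟫ := by
      rw [real_inner_self_eq_norm_sq]
      have := norm_pos_iff.2 (sub_ne_zero.2 hne.symm)
      positivity
    have hmove : ∀ y b : F, D.v K y = 0 → D.v K b = 0 → ∀ q ∈ sgr (D.v K) y,
        0 ≤ ⟪q, b - y⟫ → q ∈ sgr (D.v K) b := by
      intro y b hy hb q hq hqb y'
      have e1 := hq b
      have e2 := hq y'
      rw [hy, hb] at e1
      rw [hy] at e2
      rw [hb]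
      have e3 : ⟪q, y' - b⟫ = ⟪q, y' - y⟫ - ⟪q, b - y⟫ := by
        rw [← inner_sub_right]; congr 1; abel
      rw [e3]; linarith
    have hD : (μH[(n : ℝ) - 1] : Measure F) (Dgr (D.v K) {y | D.v K y = 0}) = 0 := by
      refine measure_mono_null (t := sgr (D.v K) a ∪ sgr (D.v K) b) ?_ ?_
      · intro q hq
        simp only [Dgr, mem_iUnion] at hq
        obtain ⟨y, hy, hq⟩ := hq
        have f1 : ⟪y1 - y0, a⟫ ≤ ⟪y1 - y0, y⟫ := hamin hy
        have f2 : ⟪y1 - y0, y⟫ ≤ ⟪y1 - y0, b⟫ := hbmax hy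
        obtain ⟨s, hs⟩ := hline y hy
        obtain ⟨sa, hsa⟩ := hline a ha
        obtain ⟨sb, hsb⟩ := hline b hb
        rw [hs, hsa] at f1
        rw [hs, hsb] at f2
        simp only [inner_add_right, real_inner_smul_right] at f1 f2
        have g1 : sa ≤ s := by
          by_contra h; push Not at h; nlinarith
        have g2 : s ≤ sb := by
          by_contra h; push Not at h; nlinarith
        rcases le_total 0 ⟪q, y1 - y0⟫ with h | h
        · right
          refine hmove y b hy hb q hq ?_
          have : b - y = (sb - s) • (y1 - y0) := by rw [hs, hsb]; module
          rw [this, real_inner_smul_right]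
          exact mul_nonneg (by linarith) h
        · left
          refine hmove y a hy ha q hq ?_
          have : a - y = (sa - s) • (y1 - y0) := by rw [hs, hsa]; module
          rw [this, real_inner_smul_right]
          exact mul_nonneg_of_nonpos_of_nonpos (by linarith) h
      · rw [measure_union_null_iff]
        exact ⟨D.face_null hn hF hK' a (hcon _ ((hzi a).1 ha) (D.r_ne a)),
          D.face_null hn hF hK' b (hcon _ ((hzi b).1 hb) (D.r_ne b))⟩
    exact P2_abs (μH[(n : ℝ) - 1] : Measure F) (D.v K) (D.v_convex hKk ⟨0, h0⟩) hvc p hp hH hv0 hC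
      y0 y1 hne ((hzi y0).2 h1) ((hzi y1).2 h2) hnull hD

end Spl

end final

/-- **Corollary 1.5 (ii).** If `n ∈ {4,5}`, `o ∈ ∂K` and the solution `K` is not
smooth, then `dim N(K,o) = 2` and `dim F(K,u) = n-1` for some nonzero `u ∈ N(K,o)`. -/
theorem stmt7 {n : ℕ} (hn : n = 4 ∨ n = 5) {p : ℝ} (hp : p < 1) {τ1 τ2 : ℝ}
    (hτ1 : 0 < τ1) (hτ12 : τ1 < τ2) {f : EuclideanSpace ℝ (Fin n) → ℝ}
    (hf : ∀ u ∈ unitSphere n, τ1 < f u ∧ f u < τ2)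
    {K : Set (EuclideanSpace ℝ (Fin n))} (hK : IsConvexBody0 K)
    (hsol : IsLpSolution p f K)
    (ho : (0 : EuclideanSpace ℝ (Fin n)) ∈ frontier K)
    (hns : ¬ IsSmoothBody K) :
    Module.finrank ℝ (Submodule.span ℝ (normalCone K 0)) = 2 ∧
      ∃ u ∈ normalCone K 0, u ≠ 0 ∧
        Module.finrank ℝ (affineSpan ℝ (face K u)).direction = n - 1 := by
  have hn1 : 1 ≤ n := by omega
  have hn5 : n ≤ 5 := by omega
  have hK' := hK
  obtain ⟨hKk, hKc, hint, h0⟩ := hK'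
  simp only [IsSmoothBody, IsSmoothPt] at hns
  push Not at hns
  obtain ⟨x, hx, hxs⟩ := hns
  -- splitting adapted to a boundary point
  have hdir := exists_dir hint
  obtain ⟨e, he, M, hM0, hM⟩ := hdir x hx
  have he0 : e ≠ 0 := by rintro rfl; simp at he
  have hsub := (mkSpl e he).part1 hn1 (finrank_orth e he0) hK hp
    ((mkSpl e he).dens hKk hKc ⟨0, h0⟩ hn1 hp hτ1 hτ12 hf hsol) x hx M hM hM0 hxs
  have hmono := Submodule.finrank_mono (Submodule.span_mono (R := ℝ) hsub)
  obtain ⟨u, hu, hu0⟩ := exists_normal hKc hint x hx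
  have hnz := finrank_span_ne_zero u _ hu hu0
  have h2 : 2 ≤ Module.finrank ℝ (Submodule.span ℝ (normalCone K 0)) := by omega
  obtain ⟨e', he', M', hM0', hM'⟩ := hdir 0 ho
  have he0' : e' ≠ 0 := by rintro rfl; simp at he'
  obtain ⟨a, b⟩ := (mkSpl e' he').part23 hn1 (finrank_orth e' he0') hn5 hK hp
    ((mkSpl e' he').dens hKk hKc ⟨0, h0⟩ hn1 hp hτ1 hτ12 hf hsol) hsol.1 ho M' hM' hM0' (by omega)
  exact ⟨by omega, b⟩
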